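/- arXiv:1904.02635 — 2 statements merged into one kernel-verified Lean document; each statement's English description precedes it below -/
import Mathlib

section
/- Let n ≥ 1, s ∈ (1/2,1), 0 ≤ R₀ < R, Ω = A_{R₀,R}, and let ℓ ∈ (2, 2_s^*), where 2_s^* := 2n/(n−2s) if 2s < n and 2_s^* := ∞ otherwise. Let f̃ : ℝ → ℝ be continuously differentiable on [0,∞), identically 0 on (−∞,0), non-negative, with lim_{t→∞} f̃(t)/t^{ℓ−1} = 1 and f̃(t) ≤ C₀(1 + t^{ℓ−1}) for all t ≥ 0 and some C₀ > 0. Then the functional E satisfies the Palais–Smale condition on H^s_{Ω,0}: every sequence (u_k) ⊆ H^s_{Ω,0} such that (E(u_k)) is bounded and ‖E'(u_k)‖_* → 0 admits a subsequence converging in the norm ‖·‖_{H^s_{Ω,0}} to some u ∈ H^s_{Ω,0}. -/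
open MeasureTheory Filter Set

noncomputable section

/-- Euclidean space ℝⁿ. -/
abbrev En (n : ℕ) : Type := EuclideanSpace ℝ (Fin n)

/-- The annulus `A_{R₀,R} = {x : R₀ < |x| < R}`, understood as the ball `B_R` when `R₀ = 0`. -/
def annR (n : ℕ) (R₀ R : ℝ) : Set (En n) :=
  if R₀ = 0 then Metric.ball (0 : En n) R else {x : En n | R₀ < ‖x‖ ∧ ‖x‖ < R}

/-- The region `ℝ^{2n} ∖ (Ωᶜ × Ωᶜ)`: pairs (x,y) not both outside Ω. -/
def crossSet {n : ℕ} (Ω : Set (En n)) : Set (En n × En n) :=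
  {p : En n × En n | p.1 ∈ Ω ∨ p.2 ∈ Ω}

/-- Gagliardo integrand `|u(x) - u(y)|² / |x-y|^{n+2s}`. -/
def gagSq {n : ℕ} (s : ℝ) (u : En n → ℝ) (p : En n × En n) : ℝ :=
  |u p.1 - u p.2| ^ 2 / dist p.1 p.2 ^ ((n : ℝ) + 2 * s)

/-- Bilinear Gagliardo integrand `(u(x)-u(y))(v(x)-v(y)) / |x-y|^{n+2s}`. -/
def gagBil {n : ℕ} (s : ℝ) (u v : En n → ℝ) (p : En n × En n) : ℝ :=
  (u p.1 - u p.2) * (v p.1 - v p.2) / dist p.1 p.2 ^ ((n : ℝ) + 2 * s)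

/-- Membership in `H^s_{Ω,0}`. -/
def MemHs {n : ℕ} (s : ℝ) (Ω : Set (En n)) (u : En n → ℝ) : Prop :=
  Measurable u ∧ IntegrableOn (fun x => (u x) ^ 2) Ω ∧
    IntegrableOn (gagSq s u) (crossSet Ω)

/-- Square of the seminorm `[u]_{H^s_{Ω,0}}²`. -/
def seminormSq {n : ℕ} (c s : ℝ) (Ω : Set (En n)) (u : En n → ℝ) : ℝ :=
  (c / 2) * ∫ p in crossSet Ω, gagSq s u p

/-- The norm `‖u‖_{H^s_{Ω,0}} = ‖u‖_{L²(Ω)} + [u]_{H^s_{Ω,0}}`. -/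
def HsNorm {n : ℕ} (c s : ℝ) (Ω : Set (En n)) (u : En n → ℝ) : ℝ :=
  (∫ x in Ω, (u x) ^ 2) ^ (1/2 : ℝ) + (seminormSq c s Ω u) ^ (1/2 : ℝ)

/-- `u ∈ H^s_{Ω,0}` is a weak solution of the linear Neumann problem
`(-Δ)ˢ u + u = h` in Ω, `𝒩ₛ u = 0` outside. -/
def SolvesLin {n : ℕ} (c s : ℝ) (Ω : Set (En n)) (h u : En n → ℝ) : Prop :=
  MemHs s Ω u ∧ ∀ v : En n → ℝ, MemHs s Ω v →
    IntegrableOn (gagBil s u v) (crossSet Ω) ∧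
    IntegrableOn (fun x => u x * v x) Ω ∧
    IntegrableOn (fun x => h x * v x) Ω ∧
    (c / 2) * (∫ p in crossSet Ω, gagBil s u v p) + ∫ x in Ω, u x * v x
      = ∫ x in Ω, h x * v x

/-- Weak solution of the nonlinear Neumann problem `(-Δ)ˢ u + u = g(u)`, `u ≥ 0`. -/
def IsWeakSolution {n : ℕ} (c s : ℝ) (Ω : Set (En n)) (g : ℝ → ℝ) (u : En n → ℝ) : Prop :=
  (∀ᵐ x ∂(volume.restrict Ω), 0 ≤ u x) ∧ SolvesLin c s Ω (fun x => g (u x)) u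

/-- `u` is radial with profile `φ`. -/
def IsRadialWith {n : ℕ} (u : En n → ℝ) (φ : ℝ → ℝ) : Prop :=
  ∀ x : En n, u x = φ ‖x‖

/-- The cone `𝒞₊` of non-negative, radial, radially non-decreasing functions in `H^s_{Ω,0}`. -/
def InConePlus {n : ℕ} (s R₀ R : ℝ) (Ω : Set (En n)) (u : En n → ℝ) : Prop :=
  MemHs s Ω u ∧ (∀ x, 0 ≤ u x) ∧
    ∃ φ : ℝ → ℝ, IsRadialWith u φ ∧ MonotoneOn φ (Icc R₀ R)

/-- The cone `𝒞₋` of non-negative, radial, radially non-increasing functions in `H^s_{Ω,0}`. -/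
def InConeMinus {n : ℕ} (s R₀ R : ℝ) (Ω : Set (En n)) (u : En n → ℝ) : Prop :=
  MemHs s Ω u ∧ (∀ x, 0 ≤ u x) ∧
    ∃ φ : ℝ → ℝ, IsRadialWith u φ ∧ AntitoneOn φ (Icc R₀ R)

/-- The second radial increasing eigenvalue `λ₂^{+,r}(Ω)`. -/
def lambda2plusr {n : ℕ} (c s R₀ R : ℝ) (Ω : Set (En n)) : ℝ :=
  sInf { t : ℝ | ∃ (v : En n → ℝ) (φ : ℝ → ℝ), MemHs s Ω v ∧ IsRadialWith v φ ∧
    MonotoneOn φ (Icc R₀ R) ∧ (∫ x in Ω, v x) = 0 ∧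
    ¬ (∀ᵐ x ∂(volume.restrict Ω), v x = 0) ∧
    t = seminormSq c s Ω v / ∫ x in Ω, (v x) ^ 2 }

/-- The second radial eigenvalue `λ₂^{rad}(Ω)`. -/
def lambda2rad {n : ℕ} (c s : ℝ) (Ω : Set (En n)) : ℝ :=
  sInf { t : ℝ | ∃ (v : En n → ℝ) (φ : ℝ → ℝ), MemHs s Ω v ∧ IsRadialWith v φ ∧
    (∫ x in Ω, v x) = 0 ∧ ¬ (∀ᵐ x ∂(volume.restrict Ω), v x = 0) ∧
    t = seminormSq c s Ω v / ∫ x in Ω, (v x) ^ 2 }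

/-- The energy functional associated with the truncated problem, with `F̃(t) = ∫₀ᵗ f̃`. -/
def energy {n : ℕ} (c s : ℝ) (Ω : Set (En n)) (ftil : ℝ → ℝ) (u : En n → ℝ) : ℝ :=
  (c / 4) * (∫ p in crossSet Ω, gagSq s u p) + (1/2) * (∫ x in Ω, (u x) ^ 2)
    - ∫ x in Ω, (∫ τ in (0:ℝ)..(u x), ftil τ)

/-- The derivative of the energy functional: `E'(u)[v]`. -/
def Eprime {n : ℕ} (c s : ℝ) (Ω : Set (En n)) (ftil : ℝ → ℝ) (u v : En n → ℝ) : ℝ :=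
  (c / 2) * (∫ p in crossSet Ω, gagBil s u v p) + (∫ x in Ω, u x * v x)
    - ∫ x in Ω, ftil (u x) * v x

/-- A bounded measurable set whose intersection with every small ball centred in it has volume
comparable to that of the ball. -/
structure IsThick {n : ℕ} (Ω : Set (En n)) (κ r₀ : ℝ) : Prop where
  measurableSet : MeasurableSet Ω
  nonempty : Ω.Nonempty
  isBounded : Bornology.IsBounded Ω
  κ_pos : 0 < κ
  r₀_pos : 0 < r₀
  density : ∀ x ∈ Ω, ∀ r, 0 < r → r ≤ r₀ →
    ENNReal.ofReal (κ * r ^ n) ≤ volume (Ω ∩ Metric.ball x r)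

/-- The squared `L²(Ω)` norm as an extended non-negative number. -/
def l2E {n : ℕ} (Ω : Set (En n)) (u : En n → ℝ) : ENNReal :=
  ∫⁻ x in Ω, ENNReal.ofReal (u x ^ 2)

/-- The Gagliardo energy over `crossSet Ω` as an extended non-negative number. -/
def gagE {n : ℕ} (s : ℝ) (Ω : Set (En n)) (u : En n → ℝ) : ENNReal :=
  ∫⁻ p in crossSet Ω, ENNReal.ofReal (gagSq s u p)

/-- The part of the Gagliardo energy seen from the point `x`. -/
def gagAt {n : ℕ} (s : ℝ) (Ω : Set (En n)) (u : En n → ℝ) (x : En n) : ENNReal :=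
  ∫⁻ y in Ω, ENNReal.ofReal (gagSq s u (x, y))

lemma IsThick.volume_lt_top {n : ℕ} {Ω : Set (En n)} {κ r₀ : ℝ} (h : IsThick Ω κ r₀) :
    volume Ω < ⊤ := h.isBounded.measure_lt_top

lemma isThick_annR {n : ℕ} (hn : 1 ≤ n) {R₀ R : ℝ} (hR₀ : 0 ≤ R₀) (hR : R₀ < R) :
    ∃ κ r₀, IsThick (annR n R₀ R) κ r₀ := by
  have : Nonempty (Fin n) := ⟨⟨0, hn⟩⟩
  have hsub : annR n R₀ R ⊆ Metric.ball 0 R := by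
    intro x hx
    unfold annR at hx
    split_ifs at hx with h
    · exact hx
    · simpa using hx.2
  have hmem : ∀ z : En n, R₀ < ‖z‖ → ‖z‖ < R → z ∈ annR n R₀ R := by
    intro z h1 h2
    unfold annR
    split_ifs
    · simpa using h2
    · exact ⟨h1, h2⟩
  have hball : ∀ x ∈ annR n R₀ R, ∀ r, 0 < r → r ≤ (R - R₀) →
      ∃ z, Metric.ball z (r / 4) ⊆ annR n R₀ R ∩ Metric.ball x r := by
    intro x hx r hr hrR
    have hxR : ‖x‖ < R := by simpa using hsub hx
    have key : ∀ t : ℝ, x ≠ 0 → |t| ≤ r / 4 → R₀ + r / 4 ≤ ‖x‖ + t → ‖x‖ + t ≤ R - r / 4 →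
        ∃ z, Metric.ball z (r / 4) ⊆ annR n R₀ R ∩ Metric.ball x r := by
      intro t hx0 ht h1 h2
      have hxp : 0 < ‖x‖ := norm_pos_iff.2 hx0
      set z : En n := x + (t / ‖x‖) • x with hz
      have hzx : ‖z - x‖ = |t| := by
        rw [hz, add_sub_cancel_left, norm_smul, norm_div, norm_norm, Real.norm_eq_abs]
        field_simp
      have hzn : ‖z‖ = ‖x‖ + t := by
        have : z = (1 + t / ‖x‖) • x := by rw [hz, add_smul, one_smul]
        have h3 : 1 + t / ‖x‖ = (‖x‖ + t) / ‖x‖ := by field_simp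
        rw [this, norm_smul, h3, Real.norm_eq_abs, abs_div, abs_norm, abs_of_nonneg (by linarith)]
        field_simp
      refine ⟨z, fun y hy => ?_⟩
      have hy' : ‖y - z‖ < r / 4 := by simpa [dist_eq_norm] using hy
      have h4 : |‖y‖ - ‖z‖| ≤ ‖y - z‖ := abs_norm_sub_norm_le y z
      have h5 := abs_lt.1 (h4.trans_lt hy')
      refine ⟨hmem y (by linarith) (by linarith), ?_⟩
      rw [Metric.mem_ball, dist_eq_norm]
      calc ‖y - x‖ = ‖(y - z) + (z - x)‖ := by congr 1; abel
        _ ≤ ‖y - z‖ + ‖z - x‖ := norm_add_le _ _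
        _ < r := by rw [hzx]; linarith
    by_cases hxm : (R₀ + R) / 2 ≤ ‖x‖
    · refine key (-(r / 4)) (norm_pos_iff.1 (by linarith)) ?_ (by linarith) (by linarith)
      rw [abs_neg, abs_of_nonneg (by linarith)]
    · push Not at hxm
      by_cases h0 : R₀ = 0
      · refine ⟨x, fun y hy => ⟨?_, Metric.ball_subset_ball (by linarith) hy⟩⟩
        have hy' : ‖y - x‖ < r / 4 := by simpa [dist_eq_norm] using hy
        have h4 : ‖y‖ - ‖x‖ ≤ ‖y - x‖ := norm_sub_norm_le y x
        unfold annR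
        rw [if_pos h0]
        simp only [Metric.mem_ball, dist_zero_right]
        linarith
      · have hx1 : R₀ < ‖x‖ := by
          unfold annR at hx
          rw [if_neg h0] at hx
          exact hx.1
        exact key (r / 4) (norm_pos_iff.1 (by linarith)) (by rw [abs_of_nonneg (by linarith)])
          (by linarith) (by linarith)
  have hv0 : volume (Metric.ball (0 : En n) 1) ≠ 0 := (Metric.measure_ball_pos _ _ one_pos).ne'
  have hvt : volume (Metric.ball (0 : En n) 1) ≠ ⊤ := measure_ball_lt_top.ne
  refine ⟨(1 / 4) ^ n * (volume (Metric.ball (0 : En n) 1)).toReal, R - R₀, ?_, ?_, ?_, ?_,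
    by linarith, ?_⟩
  · unfold annR
    split_ifs
    · exact measurableSet_ball
    · exact (measurableSet_lt measurable_const measurable_norm).inter
        (measurableSet_lt measurable_norm measurable_const)
  · obtain ⟨z, hz⟩ := NormedSpace.exists_lt_norm ℝ (En n) 0
    refine ⟨((R₀ + R) / 2 / ‖z‖) • z, hmem _ ?_ ?_⟩ <;>
    · rw [norm_smul, norm_div, norm_norm, div_mul_cancel₀ _ hz.ne', Real.norm_eq_abs,
        abs_of_nonneg (by linarith)]
      linarith
  · exact Metric.isBounded_ball.subset hsub
  · exact mul_pos (by positivity) (ENNReal.toReal_pos hv0 hvt)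
  · intro x hx r hr hrR
    obtain ⟨z, hz⟩ := hball x hx r hr hrR
    refine le_trans (le_of_eq ?_) (measure_mono hz)
    rw [Measure.addHaar_ball volume z (by linarith), finrank_euclideanSpace_fin,
      mul_right_comm, ← mul_pow, ENNReal.ofReal_mul (by positivity), ENNReal.ofReal_toReal hvt]
    congr 3
    ring

lemma measurable_gagSq {n : ℕ} {s : ℝ} {u : En n → ℝ} (hu : Measurable u) :
    Measurable (gagSq s u) := by
  unfold gagSq
  fun_prop

lemma measurable_gagBil {n : ℕ} {s : ℝ} {u v : En n → ℝ} (hu : Measurable u)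
    (hv : Measurable v) : Measurable (gagBil s u v) := by
  unfold gagBil
  fun_prop

lemma gagSq_nonneg {n : ℕ} (s : ℝ) (u : En n → ℝ) (p : En n × En n) : 0 ≤ gagSq s u p := by
  unfold gagSq
  positivity

lemma measurable_gagAt {n : ℕ} {s : ℝ} {Ω : Set (En n)} {u : En n → ℝ}
    (hu : Measurable u) : Measurable (gagAt s Ω u) :=
  (measurable_gagSq hu).ennreal_ofReal.lintegral_prod_right'

lemma lintegral_gagAt_le {n : ℕ} {s : ℝ} {Ω : Set (En n)} {u : En n → ℝ}
    (hu : Measurable u) : ∫⁻ x in Ω, gagAt s Ω u x ≤ gagE s Ω u := by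
  unfold gagAt gagE
  rw [← lintegral_prod _ (measurable_gagSq hu).ennreal_ofReal.aemeasurable,
    Measure.prod_restrict]
  exact lintegral_mono_set fun p hp => Or.inl hp.1

lemma sq_sub_le_gagSq {n : ℕ} {s : ℝ} (hs : 0 < s) {u : En n → ℝ} {x y : En n} {d : ℝ}
    (hd : dist x y ≤ d) : (u x - u y) ^ 2 ≤ d ^ ((n : ℝ) + 2 * s) * gagSq s u (x, y) := by
  unfold gagSq
  rcases eq_or_ne x y with rfl | hxy
  · simp
  have hp : 0 < dist x y := dist_pos.2 hxy
  have h1 : dist x y ^ ((n : ℝ) + 2 * s) ≤ d ^ ((n : ℝ) + 2 * s) :=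
    Real.rpow_le_rpow hp.le hd (by positivity)
  have h2 : 0 < dist x y ^ ((n : ℝ) + 2 * s) := Real.rpow_pos_of_pos hp _
  simp only [sq_abs]
  rw [mul_div_assoc', le_div_iff₀ h2, mul_comm]
  exact mul_le_mul_of_nonneg_right h1 (sq_nonneg _)

lemma exists_rpow_le_gagAt {n : ℕ} (hn : 1 ≤ n) {s : ℝ} (hs : 0 < s) {Ω : Set (En n)}
    {κ r₀ : ℝ} (hΩ : IsThick Ω κ r₀) {p A : ℝ} (hp : 0 < p) (hA : 0 < A) :
    ∃ C : ℝ, 0 < C ∧ ∀ u : En n → ℝ, Measurable u →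
      ∫⁻ x in Ω, ENNReal.ofReal (|u x| ^ p) ≤ ENNReal.ofReal A → ∀ x ∈ Ω,
        ENNReal.ofReal (|u x| ^ (2 + 2 * s * p / n)) ≤
          ENNReal.ofReal C * (1 + gagAt s Ω u x) := by
  have hn0 : (0 : ℝ) < n := by exact_mod_cast hn
  have hκ := hΩ.κ_pos
  have hr₀ := hΩ.r₀_pos
  set K : ℝ := 2 ^ p * (4 * A) / κ with hK
  have hKp : 0 < K := by positivity
  set q : ℝ := 2 + 2 * s * p / n with hq
  have hqp : 0 < q := by positivity
  set c : ℝ := 3 * κ / (16 * K ^ (2 * s / n)) with hc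
  have hcp : 0 < c := by positivity
  set M : ℝ := (K / r₀ ^ n) ^ (q / p) with hM
  have hMp : 0 < M := by positivity
  refine ⟨1 / c + M, by positivity, fun u hu huA x hx => ?_⟩
  set T : ℝ := |u x| with hT
  rcases (abs_nonneg (u x)).eq_or_lt with h0 | hTp
  · rw [hT, ← h0, Real.zero_rpow hqp.ne']
    simp
  rw [← hT] at hTp
  set r : ℝ := (K / T ^ p) ^ (1 / (n : ℝ)) with hr
  have hTpp : 0 < T ^ p := by positivity
  have hrp : 0 < r := by positivity
  have hrn : r ^ n = K / T ^ p := by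
    rw [hr, ← Real.rpow_natCast, ← Real.rpow_mul (by positivity), one_div_mul_cancel hn0.ne',
      Real.rpow_one]
  rcases le_or_gt r r₀ with hrr | hrr
  · set m : ℝ := A / (T / 2) ^ p with hm
    have hT2 : 0 < (T / 2) ^ p := by positivity
    have hmp : 0 < m := by positivity
    have hκr : κ * r ^ n = 4 * m := by
      rw [hrn, hK, hm, Real.div_rpow hTp.le (by norm_num)]
      field_simp
    set D₁ : Set (En n) := {y | ENNReal.ofReal ((T / 2) ^ p) ≤ ENNReal.ofReal (|u y| ^ p)} with hD₁
    set D₂ : Set (En n) := {y | ENNReal.ofReal ((T / 2) ^ 2 / r ^ ((n : ℝ) + 2 * s)) ≤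
      ENNReal.ofReal (gagSq s u (x, y))} with hD₂
    have hm₁ : Measurable fun y => ENNReal.ofReal (|u y| ^ p) := by fun_prop
    have hm₂ : Measurable fun y => ENNReal.ofReal (gagSq s u (x, y)) :=
      ((measurable_gagSq hu).comp measurable_prodMk_left).ennreal_ofReal
    have hb₁ : volume.restrict Ω D₁ ≤ ENNReal.ofReal m := by
      have h := (mul_meas_ge_le_lintegral (μ := volume.restrict Ω) hm₁
        (ENNReal.ofReal ((T / 2) ^ p))).trans huA
      rw [hm, ENNReal.ofReal_div_of_pos hT2, ENNReal.le_div_iff_mul_le (Or.inl (by simpa using hT2))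
        (Or.inl ENNReal.ofReal_ne_top), mul_comm]
      exact h
    have hb₂ : ENNReal.ofReal ((T / 2) ^ 2 / r ^ ((n : ℝ) + 2 * s)) * volume.restrict Ω D₂ ≤
        gagAt s Ω u x := mul_meas_ge_le_lintegral hm₂ _
    have hcov : Ω ∩ Metric.ball x r ⊆ (D₁ ∪ D₂) ∩ Ω := by
      rintro y ⟨hyΩ, hyr⟩
      refine ⟨?_, hyΩ⟩
      have hd : dist x y ≤ r := by rw [dist_comm]; exact (Metric.mem_ball.1 hyr).le
      rcases le_or_gt (T / 2) |u y| with h1 | h1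
      · exact Or.inl (ENNReal.ofReal_le_ofReal (Real.rpow_le_rpow (by positivity) h1 hp.le))
      · right
        refine ENNReal.ofReal_le_ofReal ?_
        rw [div_le_iff₀ (by positivity), mul_comm]
        refine le_trans ?_ (sq_sub_le_gagSq hs hd)
        rw [← sq_abs (u x - u y)]
        have := abs_sub_abs_le_abs_sub (u x) (u y)
        exact pow_le_pow_left₀ (by positivity) (by linarith) 2
    have hvol : ENNReal.ofReal (3 * m) ≤ volume.restrict Ω D₂ := by
      have h1 : ENNReal.ofReal (3 * m) + ENNReal.ofReal m ≤
          volume.restrict Ω D₂ + ENNReal.ofReal m := by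
        calc ENNReal.ofReal (3 * m) + ENNReal.ofReal m = ENNReal.ofReal (κ * r ^ n) := by
              rw [← ENNReal.ofReal_add (by positivity) hmp.le, hκr]; congr 1; ring
          _ ≤ volume (Ω ∩ Metric.ball x r) := hΩ.density x hx r hrp hrr
          _ ≤ volume ((D₁ ∪ D₂) ∩ Ω) := measure_mono hcov
          _ = volume.restrict Ω (D₁ ∪ D₂) := (Measure.restrict_apply' hΩ.measurableSet).symm
          _ ≤ volume.restrict Ω D₁ + volume.restrict Ω D₂ := measure_union_le _ _
          _ ≤ volume.restrict Ω D₂ + ENNReal.ofReal m := by rw [add_comm]; gcongr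
      exact (ENNReal.add_le_add_iff_right ENNReal.ofReal_ne_top).1 h1
    have hkey : ENNReal.ofReal (c * T ^ q) ≤ gagAt s Ω u x := by
      refine le_trans (le_of_eq ?_) ((mul_le_mul_right hvol _).trans hb₂)
      rw [← ENNReal.ofReal_mul (by positivity)]
      congr 1
      have h3 : 3 * m = 3 / 4 * (κ * r ^ n) := by rw [hκr]; ring
      have h4 : r ^ (2 * s) = K ^ (2 * s / n) / T ^ (2 * s * p / n) := by
        rw [hr, ← Real.rpow_mul (by positivity), Real.div_rpow hKp.le hTpp.le,
          ← Real.rpow_mul hTp.le]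
        congr 2 <;> ring
      rw [h3, Real.rpow_add hrp, Real.rpow_natCast, h4, hc, hq, Real.rpow_add hTp,
        Real.rpow_two]
      have : 0 < T ^ (2 * s * p / n) := by positivity
      field_simp
      ring
    calc ENNReal.ofReal (T ^ q) = ENNReal.ofReal (1 / c) * ENNReal.ofReal (c * T ^ q) := by
          rw [← ENNReal.ofReal_mul (by positivity)]
          congr 1
          field_simp
      _ ≤ ENNReal.ofReal (1 / c + M) * (1 + gagAt s Ω u x) := by
          gcongr
          · linarith
          · exact hkey.trans le_add_self
  · have h1 : T ^ p ≤ K / r₀ ^ n := by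
      have h2 : r₀ ^ n ≤ K / T ^ p := by
        rw [← hrn]
        exact pow_le_pow_left₀ hr₀.le hrr.le n
      rw [le_div_iff₀ hTpp] at h2
      rw [le_div_iff₀ (by positivity)]
      linarith
    have h3 : T ^ q ≤ M := by
      have : T ^ q = (T ^ p) ^ (q / p) := by
        rw [← Real.rpow_mul hTp.le]
        congr 1
        field_simp
      rw [this]
      exact Real.rpow_le_rpow hTpp.le h1 (by positivity)
    calc ENNReal.ofReal (T ^ q) ≤ ENNReal.ofReal (1 / c + M) * 1 := by
          rw [mul_one]
          exact ENNReal.ofReal_le_ofReal (by linarith [one_div_pos.2 hcp])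
      _ ≤ _ := by gcongr; exact le_self_add

/-- Balls of `H^s` are bounded in `L^p(Ω)`. -/
def BoundedInLp {n : ℕ} (s : ℝ) (Ω : Set (En n)) (p : ℝ) : Prop :=
  ∀ A : ℝ, 0 < A → ∃ C : ℝ, 0 < C ∧ ∀ u : En n → ℝ, Measurable u →
    l2E Ω u ≤ ENNReal.ofReal A → gagE s Ω u ≤ ENNReal.ofReal A →
      ∫⁻ x in Ω, ENNReal.ofReal (|u x| ^ p) ≤ ENNReal.ofReal C

lemma boundedInLp_two {n : ℕ} (s : ℝ) (Ω : Set (En n)) : BoundedInLp s Ω 2 := by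
  intro A hA
  refine ⟨A, hA, fun u _ h _ => ?_⟩
  simpa [l2E] using h

lemma BoundedInLp.gain {n : ℕ} (hn : 1 ≤ n) {s : ℝ} (hs : 0 < s) {Ω : Set (En n)}
    {κ r₀ : ℝ} (hΩ : IsThick Ω κ r₀) {p : ℝ} (hp : 0 < p) (h : BoundedInLp s Ω p) :
    BoundedInLp s Ω (2 + 2 * s * p / n) := by
  intro A hA
  obtain ⟨C, hC, hCu⟩ := h A hA
  obtain ⟨C', hC', hCu'⟩ := exists_rpow_le_gagAt hn hs hΩ hp hC
  refine ⟨C' * ((volume Ω).toReal + A), by positivity, fun u hu h1 h2 => ?_⟩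
  calc ∫⁻ x in Ω, ENNReal.ofReal (|u x| ^ (2 + 2 * s * p / n))
      ≤ ∫⁻ x in Ω, ENNReal.ofReal C' * (1 + gagAt s Ω u x) :=
        setLIntegral_mono (((measurable_gagAt hu).const_add 1).const_mul _)
          (hCu' u hu (hCu u hu h1 h2))
    _ = ENNReal.ofReal C' * (volume Ω + ∫⁻ x in Ω, gagAt s Ω u x) := by
        rw [lintegral_const_mul _ ((measurable_gagAt hu).const_add 1),
          lintegral_add_left measurable_const]
        simp
    _ ≤ ENNReal.ofReal C' * (ENNReal.ofReal (volume Ω).toReal + ENNReal.ofReal A) := by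
        rw [ENNReal.ofReal_toReal hΩ.volume_lt_top.ne]
        gcongr
        exact (lintegral_gagAt_le hu).trans h2
    _ = _ := by
        rw [ENNReal.ofReal_mul hC'.le, ENNReal.ofReal_add (by positivity) hA.le]

lemma exists_boundedInLp {n : ℕ} (hn : 1 ≤ n) {s : ℝ} (hs : 0 < s) {Ω : Set (En n)}
    {κ r₀ : ℝ} (hΩ : IsThick Ω κ r₀) {l : ℝ}
    (hlsub : 2 * s < n → l < 2 * n / ((n : ℝ) - 2 * s)) :
    ∃ q, l < q ∧ BoundedInLp s Ω q := by
  by_contra! hcon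
  have hn0 : (0 : ℝ) < n := by exact_mod_cast hn
  obtain ⟨η, hη, hstep⟩ : ∃ η : ℝ, 0 < η ∧ ∀ p, 0 < p → p ≤ l → p + η ≤ 2 + 2 * s * p / n := by
    rcases lt_or_ge (2 * s) n with h | h
    · have h1 := hlsub h
      rw [lt_div_iff₀ (by linarith)] at h1
      refine ⟨(2 * n - l * (n - 2 * s)) / n, div_pos (by linarith) hn0, fun p hp hpl => ?_⟩
      have : 2 + 2 * s * p / n - (p + (2 * n - l * (n - 2 * s)) / n) =
          (l - p) * (n - 2 * s) / n := by
        field_simp; ring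
      have h2 : 0 ≤ (l - p) * (n - 2 * s) / n :=
        div_nonneg (mul_nonneg (by linarith) (by linarith)) hn0.le
      linarith
    · refine ⟨2, two_pos, fun p hp hpl => ?_⟩
      have : p ≤ 2 * s * p / n := by
        rw [le_div_iff₀ hn0, mul_comm]
        exact mul_le_mul_of_nonneg_right h hp.le
      linarith
  have hall : ∀ j : ℕ, ∃ p, 2 + j * η ≤ p ∧ BoundedInLp s Ω p := by
    intro j
    induction j with
    | zero => exact ⟨2, by simp, boundedInLp_two s Ω⟩
    | succ j ih =>
      obtain ⟨p, hp1, hp2⟩ := ih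
      have hp0 : 0 < p := by
        have : 0 ≤ j * η := by positivity
        linarith
      have hpl : p ≤ l := by
        by_contra! hlp
        exact hcon p hlp hp2
      refine ⟨_, ?_, hp2.gain hn hs hΩ hp0⟩
      have := hstep p hp0 hpl
      push_cast
      linarith
  obtain ⟨j, hj⟩ := exists_nat_gt (l / η)
  obtain ⟨p, hp1, hp2⟩ := hall j
  rw [div_lt_iff₀ hη] at hj
  exact hcon p (by linarith) hp2

lemma l2E_sub_le {n : ℕ} {Ω : Set (En n)} {u v : En n → ℝ} (hu : Measurable u)
    (hv : Measurable v) : l2E Ω (fun x => u x - v x) ≤ 2 * (l2E Ω u + l2E Ω v) := by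
  unfold l2E
  rw [← lintegral_add_left (by fun_prop), ← lintegral_const_mul _ (by fun_prop)]
  refine lintegral_mono fun x => ?_
  rw [← ENNReal.ofReal_add (sq_nonneg _) (sq_nonneg _), ← ENNReal.ofReal_ofNat 2,
    ← ENNReal.ofReal_mul (by norm_num)]
  exact ENNReal.ofReal_le_ofReal (by nlinarith [sq_nonneg (u x + v x)])

lemma gagSq_sub_le {n : ℕ} (s : ℝ) (u v : En n → ℝ) (p : En n × En n) :
    gagSq s (fun x => u x - v x) p ≤ 2 * (gagSq s u p + gagSq s v p) := by
  unfold gagSq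
  rw [← add_div, mul_div_assoc']
  gcongr
  simp only [sq_abs]
  nlinarith [sq_nonneg ((u p.1 - u p.2) + (v p.1 - v p.2))]

lemma gagE_sub_le {n : ℕ} {s : ℝ} {Ω : Set (En n)} {u v : En n → ℝ} (hu : Measurable u)
    (hv : Measurable v) : gagE s Ω (fun x => u x - v x) ≤ 2 * (gagE s Ω u + gagE s Ω v) := by
  unfold gagE
  have h1 := (measurable_gagSq (s := s) hu).ennreal_ofReal
  have h2 := (measurable_gagSq (s := s) hv).ennreal_ofReal
  rw [← lintegral_add_left h1, ← lintegral_const_mul _ (h1.fun_add h2)]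
  refine lintegral_mono fun x => ?_
  rw [← ENNReal.ofReal_add (gagSq_nonneg _ _ _) (gagSq_nonneg _ _ _), ← ENNReal.ofReal_ofNat 2,
    ← ENNReal.ofReal_mul (by norm_num)]
  exact ENNReal.ofReal_le_ofReal (gagSq_sub_le s u v x)

lemma integrableOn_sq_of_l2E {n : ℕ} {Ω : Set (En n)} {u : En n → ℝ} (hu : Measurable u)
    (h : l2E Ω u < ⊤) : IntegrableOn (fun x => u x ^ 2) Ω :=
  ⟨(hu.pow_const 2).aestronglyMeasurable,
    (hasFiniteIntegral_iff_ofReal (ae_of_all _ fun x => sq_nonneg (u x))).2 h⟩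

lemma IsThick.integrableOn_of_l2E {n : ℕ} {Ω : Set (En n)} {κ r₀ : ℝ} (hΩ : IsThick Ω κ r₀)
    {u : En n → ℝ} (hu : Measurable u) (h : l2E Ω u < ⊤) : IntegrableOn u Ω := by
  have hc : IntegrableOn (fun _ : En n => (1 : ℝ)) Ω :=
    integrableOn_const hΩ.volume_lt_top.ne
  refine Integrable.mono' (hc.add (integrableOn_sq_of_l2E hu h)) hu.aestronglyMeasurable
    (ae_of_all _ fun x => ?_)
  simp only [Pi.add_apply, Real.norm_eq_abs]
  rw [abs_le]
  constructor <;> nlinarith [sq_nonneg (u x + 1), sq_nonneg (u x - 1)]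

lemma IsThick.sq_le_average {n : ℕ} {s : ℝ} (hs : 0 < s) {Ω : Set (En n)} {κ r₀ : ℝ}
    (hΩ : IsThick Ω κ r₀) {w : En n → ℝ} (hw : Measurable w) (hwL : l2E Ω w < ⊤) {z x : En n}
    {r : ℝ} (hz : z ∈ Ω) (hr : 0 < r) (hr₀ : r ≤ r₀) (hx : x ∈ Metric.ball z r) :
    ENNReal.ofReal (w x ^ 2) ≤
      ENNReal.ofReal (2 * (∫ y in Ω ∩ Metric.ball z r, w y) ^ 2 / (κ * r ^ n) ^ 2) +
        ENNReal.ofReal (2 * (2 * r) ^ ((n : ℝ) + 2 * s) / (κ * r ^ n)) * gagAt s Ω w x := by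
  have hκ := hΩ.κ_pos
  set D := Ω ∩ Metric.ball z r with hD
  have hDΩ : D ⊆ Ω := inter_subset_left
  have hDm : MeasurableSet D := hΩ.measurableSet.inter measurableSet_ball
  have hDt : volume D < ⊤ := (measure_mono hDΩ).trans_lt hΩ.volume_lt_top
  set V := (volume D).toReal with hV
  set d := κ * r ^ n with hd
  have hdp : 0 < d := by positivity
  have hdV : d ≤ V := by
    rw [hV, ← ENNReal.ofReal_le_iff_le_toReal hDt.ne]
    exact hΩ.density z hz r hr hr₀
  have hVp : 0 < V := hdp.trans_le hdV
  have hwi : IntegrableOn w D := (hΩ.integrableOn_of_l2E hw hwL).mono_set hDΩ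
  have hwi2 : IntegrableOn (fun y => w y ^ 2) D := (integrableOn_sq_of_l2E hw hwL).mono_set hDΩ
  have hci : ∀ a : ℝ, IntegrableOn (fun _ : En n => a) D := fun a => integrableOn_const hDt.ne
  have hsub2 : IntegrableOn (fun y => (w x - w y) ^ 2) D := by
    have : (fun y => (w x - w y) ^ 2) = fun y => w x ^ 2 - 2 * w x * w y + w y ^ 2 := by
      ext y; ring
    rw [this]
    exact ((hci _).sub (hwi.const_mul _)).add hwi2
  set a := ∫ y in D, w y with ha
  set I := ∫ y in D, (w x - w y) ^ 2 with hI
  have hint : ∀ b : ℝ, ∫ _ in D, b = V * b := fun b => by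
    rw [setIntegral_const, smul_eq_mul]; rfl
  have h1 : V * w x ^ 2 - w x * a ≤ V * (w x ^ 2 / 4) + I := by
    have e1 : V * w x ^ 2 - w x * a = ∫ y in D, (w x ^ 2 - w x * w y) := by
      rw [integral_sub (hci _) (hwi.const_mul _), hint, integral_const_mul]
    have e2 : V * (w x ^ 2 / 4) + I = ∫ y in D, (w x ^ 2 / 4 + (w x - w y) ^ 2) := by
      rw [integral_add (hci _) hsub2, hint]
    rw [e1, e2]
    refine integral_mono ((hci _).sub (hwi.const_mul _)) ((hci _).add hsub2) fun y => ?_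
    simp only
    nlinarith [sq_nonneg (w x / 2 - (w x - w y))]
  have h2 : w x * a ≤ V * (w x ^ 2 / 4) + a ^ 2 / V := by
    have : V * (w x ^ 2 / 4) + a ^ 2 / V - w x * a = (V * w x / 2 - a) ^ 2 / V := by
      field_simp; ring
    have h3 : 0 ≤ (V * w x / 2 - a) ^ 2 / V := by positivity
    linarith
  have hI0 : 0 ≤ I := integral_nonneg fun y => sq_nonneg _
  have h4 : w x ^ 2 ≤ 2 * a ^ 2 / d ^ 2 + 2 / d * I := by
    have h5 : w x ^ 2 ≤ 2 * a ^ 2 / V ^ 2 + 2 / V * I := by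
      have h6 : V * w x ^ 2 / 2 ≤ I + a ^ 2 / V := by linarith
      have h7 : w x ^ 2 = 2 / V * (V * w x ^ 2 / 2) := by field_simp
      rw [h7]
      refine (mul_le_mul_of_nonneg_left h6 (by positivity)).trans (le_of_eq ?_)
      field_simp; ring
    refine h5.trans ?_
    gcongr
  have h8 : ENNReal.ofReal I ≤ ENNReal.ofReal ((2 * r) ^ ((n : ℝ) + 2 * s)) * gagAt s Ω w x := by
    have hm : Measurable fun y => ENNReal.ofReal (gagSq s w (x, y)) :=
      ((measurable_gagSq hw).comp measurable_prodMk_left).ennreal_ofReal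
    rw [hI, ofReal_integral_eq_lintegral_ofReal hsub2 (ae_of_all _ fun y => sq_nonneg _), gagAt,
      ← lintegral_const_mul _ hm]
    refine (setLIntegral_mono (hm.const_mul _) fun y hy => ?_).trans (lintegral_mono_set hDΩ)
    rw [← ENNReal.ofReal_mul (by positivity)]
    refine ENNReal.ofReal_le_ofReal (sq_sub_le_gagSq hs ?_)
    have h9 := dist_triangle_right x y z
    have h10 := Metric.mem_ball.1 hx
    have h11 := Metric.mem_ball.1 hy.2
    linarith
  calc ENNReal.ofReal (w x ^ 2) ≤ ENNReal.ofReal (2 * a ^ 2 / d ^ 2 + 2 / d * I) :=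
        ENNReal.ofReal_le_ofReal h4
    _ = ENNReal.ofReal (2 * a ^ 2 / d ^ 2) + ENNReal.ofReal (2 / d) * ENNReal.ofReal I := by
        rw [ENNReal.ofReal_add (by positivity) (by positivity), ENNReal.ofReal_mul (by positivity)]
    _ ≤ ENNReal.ofReal (2 * a ^ 2 / d ^ 2) + ENNReal.ofReal (2 / d) *
        (ENNReal.ofReal ((2 * r) ^ ((n : ℝ) + 2 * s)) * gagAt s Ω w x) := by gcongr
    _ = _ := by
        rw [← mul_assoc, ← ENNReal.ofReal_mul (by positivity)]
        congr 3
        ring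

lemma IsThick.l2E_le_averages {n : ℕ} {s : ℝ} (hs : 0 < s) {Ω : Set (En n)} {κ r₀ : ℝ}
    (hΩ : IsThick Ω κ r₀) {w : En n → ℝ} (hw : Measurable w) (hwL : l2E Ω w < ⊤)
    {r : ℝ} (hr : 0 < r) (hr₀ : r ≤ r₀) {t : Finset (En n)} (ht : (t : Set (En n)) ⊆ Ω)
    (hcov : Ω ⊆ ⋃ z ∈ t, Metric.ball z r) :
    l2E Ω w ≤ ENNReal.ofReal ((∑ z ∈ t, 2 * (∫ y in Ω ∩ Metric.ball z r, w y) ^ 2 /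
      (κ * r ^ n) ^ 2) * (volume Ω).toReal) +
      ENNReal.ofReal (2 * 2 ^ ((n : ℝ) + 2 * s) / κ * r ^ (2 * s)) * gagE s Ω w := by
  have hκ := hΩ.κ_pos
  set S := ∑ z ∈ t, 2 * (∫ y in Ω ∩ Metric.ball z r, w y) ^ 2 / (κ * r ^ n) ^ 2 with hS
  have hterm : ∀ z ∈ t, 0 ≤ 2 * (∫ y in Ω ∩ Metric.ball z r, w y) ^ 2 / (κ * r ^ n) ^ 2 :=
    fun z _ => by positivity
  have hC : 2 * (2 * r) ^ ((n : ℝ) + 2 * s) / (κ * r ^ n) =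
      2 * 2 ^ ((n : ℝ) + 2 * s) / κ * r ^ (2 * s) := by
    rw [Real.mul_rpow (by norm_num) hr.le, Real.rpow_add hr, Real.rpow_natCast]
    field_simp
  have hpt : ∀ x ∈ Ω, ENNReal.ofReal (w x ^ 2) ≤ ENNReal.ofReal S +
      ENNReal.ofReal (2 * 2 ^ ((n : ℝ) + 2 * s) / κ * r ^ (2 * s)) * gagAt s Ω w x := by
    intro x hx
    obtain ⟨z, hz, hxz⟩ := mem_iUnion₂.1 (hcov hx)
    refine (hΩ.sq_le_average hs hw hwL (ht hz) hr hr₀ hxz).trans ?_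
    rw [hC]
    gcongr
    exact Finset.single_le_sum hterm hz
  have hm := measurable_gagAt (s := s) (Ω := Ω) hw
  calc l2E Ω w ≤ ∫⁻ x in Ω, (ENNReal.ofReal S +
      ENNReal.ofReal (2 * 2 ^ ((n : ℝ) + 2 * s) / κ * r ^ (2 * s)) * gagAt s Ω w x) :=
        setLIntegral_mono ((hm.const_mul _).const_add _) hpt
    _ = ENNReal.ofReal (S * (volume Ω).toReal) +
      ENNReal.ofReal (2 * 2 ^ ((n : ℝ) + 2 * s) / κ * r ^ (2 * s)) *
        ∫⁻ x in Ω, gagAt s Ω w x := by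
        rw [lintegral_add_left measurable_const, lintegral_const_mul _ hm,
          ENNReal.ofReal_mul (Finset.sum_nonneg hterm), ENNReal.ofReal_toReal
          hΩ.volume_lt_top.ne]
        simp [S]
    _ ≤ _ := by
        gcongr
        exact lintegral_gagAt_le hw

lemma exists_subseq_cauchy_l2E {n : ℕ} {s : ℝ} (hs : 0 < s) {Ω : Set (En n)} {κ r₀ : ℝ}
    (hΩ : IsThick Ω κ r₀) {u : ℕ → En n → ℝ} (hu : ∀ k, Measurable (u k)) {A : ℝ} (hA : 0 < A)
    (hL : ∀ k, l2E Ω (u k) ≤ ENNReal.ofReal A) (hG : ∀ k, gagE s Ω (u k) ≤ ENNReal.ofReal A) :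
    ∃ φ : ℕ → ℕ, StrictMono φ ∧
      Tendsto (fun p : ℕ × ℕ => l2E Ω (fun x => u (φ p.1) x - u (φ p.2) x)) atTop (nhds 0) := by
  have hκ := hΩ.κ_pos
  have hr₀ := hΩ.r₀_pos
  set ρ : ℕ → ℝ := fun m => r₀ / (m + 1) with hρ
  have hρp : ∀ m, 0 < ρ m := fun m => by positivity
  have hρr : ∀ m, ρ m ≤ r₀ := fun m => by
    rw [hρ]
    exact div_le_self hr₀.le (by linarith [(Nat.cast_nonneg m : (0 : ℝ) ≤ m)])
  have hcovers : ∀ m, ∃ t : Finset (En n), (t : Set (En n)) ⊆ Ω ∧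
      Ω ⊆ ⋃ z ∈ t, Metric.ball z (ρ m) := by
    intro m
    obtain ⟨t, ht1, ht2, ht3⟩ := Metric.finite_approx_of_totallyBounded
      ((Bornology.IsBounded.isCompact_closure hΩ.isBounded).totallyBounded.subset subset_closure) (ρ m) (hρp m)
    exact ⟨ht2.toFinset, by simpa using ht1, by simpa using ht3⟩
  choose t ht hcov using hcovers
  have hui : ∀ k, IntegrableOn (u k) Ω := fun k =>
    hΩ.integrableOn_of_l2E (hu k) ((hL k).trans_lt ENNReal.ofReal_lt_top)
  have huL : ∀ k, ∫ x in Ω, u k x ^ 2 ≤ A := fun k => by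
    rw [integral_eq_lintegral_of_nonneg_ae (ae_of_all _ fun x => sq_nonneg _)
      ((hu k).pow_const 2).aestronglyMeasurable]
    exact ENNReal.toReal_le_of_le_ofReal hA.le (hL k)
  set avg : ℕ → (Σ m, t m) → ℝ := fun k i => ∫ y in Ω ∩ Metric.ball i.2.1 (ρ i.1), u k y with havg
  set B : ℝ := (volume Ω).toReal + A with hB
  have hbound : ∀ k, avg k ∈ Set.pi univ fun _ : (Σ m, t m) => Icc (-B) B := by
    intro k i _
    rw [mem_Icc, ← abs_le]
    have h1 : ‖avg k i‖ ≤ ∫ y in Ω ∩ Metric.ball i.2.1 (ρ i.1), ‖u k y‖ :=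
      norm_integral_le_integral_norm _
    have h2 : ∫ y in Ω ∩ Metric.ball i.2.1 (ρ i.1), ‖u k y‖ ≤ ∫ y in Ω, ‖u k y‖ :=
      setIntegral_mono_set (hui k).norm (ae_of_all _ fun x => norm_nonneg _)
        (ae_of_all _ fun x hx => hx.1)
    have h3 : ∫ y in Ω, ‖u k y‖ ≤ ∫ y in Ω, (1 + u k y ^ 2) := by
      have hc : IntegrableOn (fun _ : En n => (1 : ℝ)) Ω :=
        integrableOn_const hΩ.volume_lt_top.ne
      refine integral_mono (hui k).norm (hc.add (integrableOn_sq_of_l2E (hu k)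
        ((hL k).trans_lt ENNReal.ofReal_lt_top))) fun x => ?_
      simp only [Real.norm_eq_abs]
      rw [← sq_abs]
      nlinarith [sq_nonneg (|u k x| - 1)]
    have h4 : ∫ y in Ω, (1 + u k y ^ 2) = (volume Ω).toReal + ∫ y in Ω, u k y ^ 2 := by
      have hc : IntegrableOn (fun _ : En n => (1 : ℝ)) Ω :=
        integrableOn_const hΩ.volume_lt_top.ne
      rw [integral_add hc
        (integrableOn_sq_of_l2E (hu k) ((hL k).trans_lt ENNReal.ofReal_lt_top))]
      simp [Measure.real]
    have h5 := huL k
    rw [Real.norm_eq_abs] at h1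
    linarith
  obtain ⟨a, -, φ, hφ, hlim⟩ := (isCompact_univ_pi fun _ : (Σ m, t m) =>
    isCompact_Icc (a := -B) (b := B)).tendsto_subseq hbound
  refine ⟨φ, hφ, ?_⟩
  have hlim' : ∀ i : (Σ m, t m), Tendsto (fun p : ℕ × ℕ =>
      ∫ y in Ω ∩ Metric.ball i.2.1 (ρ i.1), (u (φ p.1) y - u (φ p.2) y)) atTop (nhds 0) := by
    intro i
    have h1 : Tendsto (fun k => avg (φ k) i) atTop (nhds (a i)) := tendsto_pi_nhds.1 hlim i
    rw [← prod_atTop_atTop_eq]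
    have h2 := (h1.comp tendsto_fst).sub (h1.comp (tendsto_snd (f := (atTop : Filter ℕ))))
    rw [sub_self] at h2
    refine h2.congr fun p => ?_
    exact (integral_sub ((hui _).mono_set inter_subset_left)
      ((hui _).mono_set inter_subset_left)).symm
  have hGsub : ∀ j k, gagE s Ω (fun x => u j x - u k x) ≤ ENNReal.ofReal (4 * A) := by
    intro j k
    refine (gagE_sub_le (hu j) (hu k)).trans ?_
    calc 2 * (gagE s Ω (u j) + gagE s Ω (u k))
        ≤ 2 * (ENNReal.ofReal A + ENNReal.ofReal A) := by gcongr <;> apply hG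
      _ = ENNReal.ofReal (4 * A) := by
        rw [← ENNReal.ofReal_add hA.le hA.le, ← ENNReal.ofReal_ofNat 2,
          ← ENNReal.ofReal_mul (by norm_num)]
        congr 1; ring
  have hLsub : ∀ j k, l2E Ω (fun x => u j x - u k x) < ⊤ := fun j k =>
    (l2E_sub_le (hu j) (hu k)).trans_lt (ENNReal.mul_lt_top (by simp)
      (ENNReal.add_lt_top.2 ⟨(hL j).trans_lt ENNReal.ofReal_lt_top,
        (hL k).trans_lt ENNReal.ofReal_lt_top⟩))
  set Cb : ℝ := 2 * 2 ^ ((n : ℝ) + 2 * s) / κ with hCb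
  have hCbp : 0 < Cb := by positivity
  have hest : ∀ m (p : ℕ × ℕ), l2E Ω (fun x => u (φ p.1) x - u (φ p.2) x) ≤
      ENNReal.ofReal ((∑ z : t m, 2 * (∫ y in Ω ∩ Metric.ball z.1 (ρ m),
        (u (φ p.1) y - u (φ p.2) y)) ^ 2 / (κ * ρ m ^ n) ^ 2) * (volume Ω).toReal +
        Cb * ρ m ^ (2 * s) * (4 * A)) := by
    intro m p
    have h1 := hΩ.l2E_le_averages hs ((hu (φ p.1)).sub (hu (φ p.2))) (hLsub _ _)
      (hρp m) (hρr m) (ht m) (hcov m)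
    have hρs : 0 < ρ m ^ (2 * s) := Real.rpow_pos_of_pos (hρp m) _
    rw [← Finset.sum_coe_sort] at h1
    refine h1.trans ?_
    rw [ENNReal.ofReal_add (by positivity) (by positivity),
      ENNReal.ofReal_mul (p := Cb * ρ m ^ (2 * s)) (by positivity)]
    exact add_le_add le_rfl (mul_le_mul_right (hGsub _ _) _)
  rw [ENNReal.tendsto_nhds_zero]
  intro ε hε
  obtain ⟨δ, hδ, hδε⟩ : ∃ δ : ℝ, 0 < δ ∧ ENNReal.ofReal δ ≤ ε := by
    rcases eq_or_ne ε ⊤ with rfl | hεt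
    · exact ⟨1, one_pos, le_top⟩
    · exact ⟨ε.toReal, ENNReal.toReal_pos hε.ne' hεt, (ENNReal.ofReal_toReal hεt).le⟩
  have hρ0 : Tendsto (fun m => Cb * ρ m ^ (2 * s) * (4 * A)) atTop (nhds 0) := by
    have h1 : Tendsto ρ atTop (nhds 0) := by
      have := (tendsto_one_div_add_atTop_nhds_zero_nat (𝕜 := ℝ)).const_mul r₀
      rw [mul_zero] at this
      exact this.congr fun m => by rw [hρ]; ring
    have h2 := h1.rpow_const (p := 2 * s) (Or.inr (by positivity))
    rw [Real.zero_rpow (by positivity)] at h2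
    have h3 := (h2.const_mul Cb).mul_const (4 * A)
    rwa [mul_zero, zero_mul] at h3
  obtain ⟨m, hm⟩ := (hρ0.eventually_lt_const (half_pos hδ)).exists
  have hsum : Tendsto (fun p : ℕ × ℕ => (∑ z : t m, 2 * (∫ y in Ω ∩ Metric.ball z.1 (ρ m),
        (u (φ p.1) y - u (φ p.2) y)) ^ 2 / (κ * ρ m ^ n) ^ 2) * (volume Ω).toReal)
        atTop (nhds 0) := by
    have h1 : Tendsto (fun p : ℕ × ℕ => ∑ z : t m, 2 * (∫ y in Ω ∩ Metric.ball z.1 (ρ m),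
        (u (φ p.1) y - u (φ p.2) y)) ^ 2 / (κ * ρ m ^ n) ^ 2) atTop
        (nhds (∑ z : t m, 2 * (0 : ℝ) ^ 2 / (κ * ρ m ^ n) ^ 2)) :=
      tendsto_finsetSum _ fun z _ => (((hlim' ⟨m, z⟩).pow 2).const_mul 2).div_const _
    have h2 := h1.mul_const (volume Ω).toReal
    simpa using h2
  filter_upwards [hsum.eventually_lt_const (half_pos hδ)] with p hp
  exact (hest m p).trans ((ENNReal.ofReal_le_ofReal (by linarith)).trans hδε)

lemma abs_le_add_sq_div {δ : ℝ} (hδ : 0 < δ) (t : ℝ) : |t| ≤ δ + t ^ 2 / δ := by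
  have h : δ + t ^ 2 / δ - |t| = ((δ - |t| / 2) ^ 2 + 3 / 4 * |t| ^ 2) / δ := by
    field_simp
    rw [sq_abs]
    ring_nf
    rw [sq_abs]
    ring
  have : 0 ≤ ((δ - |t| / 2) ^ 2 + 3 / 4 * |t| ^ 2) / δ := by positivity
  linarith

lemma rpow_mul_le_add {l δ a b : ℝ} (hl : 1 < l) (hδ : 0 < δ) (ha : 0 ≤ a) (hb : 0 ≤ b) :
    a ^ (l - 1) * b ≤ δ * a ^ l + δ ^ (1 - l) * b ^ l := by
  have hl1 : l - 1 + 1 ≠ 0 := by linarith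
  have hl0 : 0 < l - 1 := by linarith
  have h1 : ∀ x : ℝ, 0 ≤ x → x ^ l = x ^ (l - 1) * x := fun x hx => by
    conv_lhs => rw [show l = l - 1 + 1 by ring, Real.rpow_add_one' hx hl1]
  rcases le_or_gt b (δ * a) with h | h
  · have : a ^ (l - 1) * b ≤ δ * a ^ l := by
      rw [h1 a ha]
      calc a ^ (l - 1) * b ≤ a ^ (l - 1) * (δ * a) := by gcongr
        _ = _ := by ring
    have h2 : 0 ≤ δ ^ (1 - l) * b ^ l := by positivity
    linarith
  · have : a ^ (l - 1) * b ≤ δ ^ (1 - l) * b ^ l := by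
      have h3 : a ≤ b / δ := by rw [le_div_iff₀ hδ]; linarith
      calc a ^ (l - 1) * b ≤ (b / δ) ^ (l - 1) * b := by gcongr
        _ = δ ^ (1 - l) * b ^ l := by
          rw [Real.div_rpow hb hδ.le, h1 b hb, show 1 - l = -(l - 1) by ring, Real.rpow_neg hδ.le]
          field_simp
    have h2 : 0 ≤ δ * a ^ l := by positivity
    linarith

/-- The structural assumptions on the nonlinearity used in the Palais–Smale argument. -/
structure IsSubcritical (f : ℝ → ℝ) (l C₀ : ℝ) : Prop where
  two_lt : 2 < l
  C₀_pos : 0 < C₀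
  measurable : Measurable f
  eq_zero : ∀ t < (0 : ℝ), f t = 0
  nonneg : ∀ t, 0 ≤ f t
  growth : ∀ t ≥ (0 : ℝ), f t ≤ C₀ * (1 + t ^ (l - 1))
  asymptotic : Tendsto (fun t => f t / t ^ (l - 1)) atTop (nhds 1)

namespace IsSubcritical

variable {f : ℝ → ℝ} {l C₀ : ℝ}

lemma le_abs (h : IsSubcritical f l C₀) (t : ℝ) : f t ≤ C₀ * (1 + |t| ^ (l - 1)) := by
  have := h.C₀_pos
  rcases le_or_gt 0 t with ht | ht
  · simpa [abs_of_nonneg ht] using h.growth t ht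
  · rw [h.eq_zero t ht]
    positivity

lemma abs_mul_le (h : IsSubcritical f l C₀) {δ : ℝ} (hδ : 0 < δ) (t w : ℝ) :
    |f t * w| ≤ C₀ * (δ + w ^ 2 / δ + δ * |t| ^ l + δ ^ (1 - l) * |w| ^ l) := by
  rw [abs_mul, abs_of_nonneg (h.nonneg t)]
  have hC := h.C₀_pos
  have h1 := abs_le_add_sq_div hδ w
  have h2 := rpow_mul_le_add (by linarith [h.two_lt] : 1 < l) hδ (abs_nonneg t) (abs_nonneg w)
  calc f t * |w| ≤ C₀ * (1 + |t| ^ (l - 1)) * |w| :=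
        mul_le_mul_of_nonneg_right (h.le_abs t) (abs_nonneg w)
    _ = C₀ * (|w| + |t| ^ (l - 1) * |w|) := by ring
    _ ≤ _ := mul_le_mul_of_nonneg_left (by linarith) hC.le

lemma intervalIntegrable (h : IsSubcritical f l C₀) (a b : ℝ) :
    IntervalIntegrable f volume a b := by
  have hc : Continuous fun t : ℝ => C₀ * (1 + |t| ^ (l - 1)) := by
    have := continuous_abs.rpow_const (p := l - 1)
      fun _ : ℝ => Or.inr (by linarith [h.two_lt] : (0 : ℝ) ≤ l - 1)
    fun_prop
  refine (hc.intervalIntegrable a b).mono_fun' h.measurable.aestronglyMeasurable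
    (ae_of_all _ fun t => ?_)
  beta_reduce
  rw [Real.norm_eq_abs, abs_of_nonneg (h.nonneg t)]
  exact h.le_abs t

lemma continuous_primitive (h : IsSubcritical f l C₀) :
    Continuous fun t => ∫ τ in (0 : ℝ)..t, f τ :=
  intervalIntegral.continuous_primitive h.intervalIntegrable 0

lemma primitive_of_nonpos (h : IsSubcritical f l C₀) {t : ℝ} (ht : t ≤ 0) :
    ∫ τ in (0 : ℝ)..t, f τ = 0 := by
  refine intervalIntegral.integral_zero_ae ?_
  have h0 : ∀ᵐ x : ℝ, x ≠ 0 := compl_mem_ae_iff.2 (measure_singleton 0)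
  filter_upwards [h0] with x hx hxt
  rw [uIoc_of_ge ht] at hxt
  exact h.eq_zero x (lt_of_le_of_ne hxt.2 hx)

lemma primitive_nonneg (h : IsSubcritical f l C₀) (t : ℝ) : 0 ≤ ∫ τ in (0 : ℝ)..t, f τ := by
  rcases le_or_gt 0 t with ht | ht
  · exact intervalIntegral.integral_nonneg ht fun x _ => h.nonneg x
  · exact (h.primitive_of_nonpos ht.le).ge

/-- The Ambrosetti–Rabinowitz condition, up to an additive constant. -/
lemma exists_ambrosetti_rabinowitz (h : IsSubcritical f l C₀) :
    ∃ μ C : ℝ, 2 < μ ∧ 0 ≤ C ∧ ∀ t, μ * (∫ τ in (0 : ℝ)..t, f τ) ≤ f t * t + C := by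
  have hl := h.two_lt
  set μ : ℝ := (l + 2) / 2 with hμ
  set δ : ℝ := (l - 2) / (3 * l + 2) with hδ
  have hδp : 0 < δ := div_pos (by linarith) (by linarith)
  have hev := (h.asymptotic.eventually_lt_const (by linarith : (1 : ℝ) < 1 + δ)).and
    ((h.asymptotic.eventually_const_lt (by linarith : (1 : ℝ) - δ < 1)))
  obtain ⟨T, hT⟩ := eventually_atTop.1 (hev.and (eventually_gt_atTop (0 : ℝ)))
  have hTp : 0 < T := (hT T le_rfl).2
  have hup : ∀ t, T ≤ t → f t ≤ (1 + δ) * t ^ (l - 1) := fun t ht => by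
    have h1 := hT t ht
    have h2 : 0 < t ^ (l - 1) := Real.rpow_pos_of_pos h1.2 _
    exact ((div_lt_iff₀ h2).1 h1.1.1).le
  have hlow : ∀ t, T ≤ t → (1 - δ) * t ^ (l - 1) ≤ f t := fun t ht => by
    have h1 := hT t ht
    have h2 : 0 < t ^ (l - 1) := Real.rpow_pos_of_pos h1.2 _
    exact ((lt_div_iff₀ h2).1 h1.1.2).le
  set F : ℝ → ℝ := fun t => ∫ τ in (0 : ℝ)..t, f τ with hF
  have hFT : 0 ≤ F T := h.primitive_nonneg T
  have hft : ∀ t, 0 ≤ f t * t := fun t => by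
    rcases le_or_gt 0 t with ht | ht
    · exact mul_nonneg (h.nonneg t) ht
    · rw [h.eq_zero t ht, zero_mul]
  have hμp : 0 < μ := by linarith
  refine ⟨μ, μ * F T, by linarith, by positivity, fun t => ?_⟩
  change μ * F t ≤ _
  rcases le_or_gt t T with ht | ht
  · have hle : F t ≤ F T := by
      rcases le_or_gt t 0 with h0 | h0
      · rw [show F t = 0 from h.primitive_of_nonpos h0]
        exact hFT
      · have h1 : F t + ∫ τ in t..T, f τ = F T :=
          intervalIntegral.integral_add_adjacent_intervals (h.intervalIntegrable _ _)
            (h.intervalIntegrable _ _)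
        have h2 : 0 ≤ ∫ τ in t..T, f τ := intervalIntegral.integral_nonneg ht fun x _ => h.nonneg x
        linarith
    linarith [mul_le_mul_of_nonneg_left hle hμp.le, hft t]
  · have htp : 0 < t := hTp.trans ht
    have h1 : F T + ∫ τ in T..t, f τ = F t :=
      intervalIntegral.integral_add_adjacent_intervals (h.intervalIntegrable _ _)
        (h.intervalIntegrable _ _)
    have hpow : IntervalIntegrable (fun τ : ℝ => τ ^ (l - 1)) volume T t :=
      intervalIntegral.intervalIntegrable_rpow' (by linarith)
    have h2 : ∫ τ in T..t, f τ ≤ ∫ τ in T..t, (1 + δ) * τ ^ (l - 1) :=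
      intervalIntegral.integral_mono_on ht.le (h.intervalIntegrable _ _) (hpow.const_mul _)
        fun x hx => hup x hx.1
    rw [intervalIntegral.integral_const_mul, integral_rpow (Or.inl (by linarith)),
      sub_add_cancel] at h2
    have h3 : (t ^ l - T ^ l) / l ≤ t ^ l / l := by
      gcongr
      linarith [Real.rpow_pos_of_pos hTp l]
    have h4 : ∫ τ in T..t, f τ ≤ (1 + δ) * (t ^ l / l) :=
      h2.trans (mul_le_mul_of_nonneg_left h3 (by linarith))
    have h5 : μ * ((1 + δ) * (t ^ l / l)) = (1 - δ) * t ^ l := by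
      rw [hμ, hδ]
      have : 3 * l + 2 ≠ 0 := by linarith
      field_simp
      ring
    have h6 : (1 - δ) * t ^ l ≤ f t * t := by
      have h7 : t ^ l = t ^ (l - 1) * t := by
        rw [← Real.rpow_add_one htp.ne', sub_add_cancel]
      rw [h7, ← mul_assoc]
      exact mul_le_mul_of_nonneg_right (hlow t ht.le) htp.le
    rw [← h1, mul_add]
    linarith [mul_le_mul_of_nonneg_left h4 hμp.le]

end IsSubcritical

section HsSpace

variable {n : ℕ} {s c : ℝ} {Ω : Set (En n)} {u v : En n → ℝ}

lemma memHs_iff : MemHs s Ω u ↔ Measurable u ∧ l2E Ω u < ⊤ ∧ gagE s Ω u < ⊤ := by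
  refine and_congr_right fun hu => and_congr ?_ ?_
  · exact ⟨fun h => (hasFiniteIntegral_iff_ofReal (ae_of_all _ fun x => sq_nonneg (u x))).1 h.2,
      integrableOn_sq_of_l2E hu⟩
  · exact ⟨fun h => (hasFiniteIntegral_iff_ofReal (ae_of_all _ fun x => gagSq_nonneg s u x)).1 h.2,
      fun h => ⟨(measurable_gagSq hu).aestronglyMeasurable,
        (hasFiniteIntegral_iff_ofReal (ae_of_all _ fun x => gagSq_nonneg s u x)).2 h⟩⟩

lemma MemHs.sub (hu : MemHs s Ω u) (hv : MemHs s Ω v) : MemHs s Ω (fun x => u x - v x) := by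
  rw [memHs_iff] at *
  refine ⟨hu.1.sub hv.1, (l2E_sub_le hu.1 hv.1).trans_lt ?_,
    (gagE_sub_le hu.1 hv.1).trans_lt ?_⟩
  · exact ENNReal.mul_lt_top (by simp) (ENNReal.add_lt_top.2 ⟨hu.2.1, hv.2.1⟩)
  · exact ENNReal.mul_lt_top (by simp) (ENNReal.add_lt_top.2 ⟨hu.2.2, hv.2.2⟩)

lemma MemHs.l2E_eq (hu : MemHs s Ω u) : l2E Ω u = ENNReal.ofReal (∫ x in Ω, u x ^ 2) :=
  (ofReal_integral_eq_lintegral_ofReal hu.2.1 (ae_of_all _ fun _ => sq_nonneg _)).symm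

lemma MemHs.gagE_eq (hu : MemHs s Ω u) :
    gagE s Ω u = ENNReal.ofReal (∫ p in crossSet Ω, gagSq s u p) :=
  (ofReal_integral_eq_lintegral_ofReal hu.2.2 (ae_of_all _ fun _ => gagSq_nonneg _ _ _)).symm

lemma MemHs.integrableOn_mul (hu : MemHs s Ω u) (hv : MemHs s Ω v) :
    IntegrableOn (fun x => u x * v x) Ω := by
  refine Integrable.mono' (hu.2.1.add hv.2.1) (hu.1.mul hv.1).aestronglyMeasurable
    (ae_of_all _ fun x => ?_)
  simp only [Pi.add_apply, Real.norm_eq_abs]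
  rw [abs_le]
  constructor <;> nlinarith [sq_nonneg (u x + v x), sq_nonneg (u x - v x)]

lemma MemHs.integrableOn_gagBil (hu : MemHs s Ω u) (hv : MemHs s Ω v) :
    IntegrableOn (gagBil s u v) (crossSet Ω) := by
  refine Integrable.mono' (hu.2.2.add hv.2.2) (measurable_gagBil hu.1 hv.1).aestronglyMeasurable
    (ae_of_all _ fun p => ?_)
  have h0 : 0 ≤ dist p.1 p.2 ^ ((n : ℝ) + 2 * s) := by positivity
  simp only [Pi.add_apply, Real.norm_eq_abs, gagBil, gagSq, sq_abs]
  rw [← add_div, abs_div, abs_of_nonneg h0]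
  refine div_le_div_of_nonneg_right ?_ h0
  rw [abs_le]
  constructor <;> nlinarith [sq_nonneg ((u p.1 - u p.2) + (v p.1 - v p.2)),
    sq_nonneg ((u p.1 - u p.2) - (v p.1 - v p.2))]

/-- The square of the Hilbert norm `([u]² + ‖u‖²_{L²})^{1/2}`. -/
def hsSq (c s : ℝ) (Ω : Set (En n)) (u : En n → ℝ) : ℝ :=
  (c / 2) * (∫ p in crossSet Ω, gagSq s u p) + ∫ x in Ω, u x ^ 2

lemma integral_gagSq_nonneg : 0 ≤ ∫ p in crossSet Ω, gagSq s u p :=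
  integral_nonneg fun p => gagSq_nonneg s u p

lemma integral_sq_nonneg : 0 ≤ ∫ x in Ω, u x ^ 2 := integral_nonneg fun _ => sq_nonneg _

lemma hsSq_nonneg (hc : 0 < c) : 0 ≤ hsSq c s Ω u :=
  add_nonneg (mul_nonneg (by positivity) integral_gagSq_nonneg) integral_sq_nonneg

lemma HsNorm_le (hc : 0 < c) : HsNorm c s Ω u ≤ 2 * √(hsSq c s Ω u) := by
  have h1 : 0 ≤ (c / 2) * ∫ p in crossSet Ω, gagSq s u p :=
    mul_nonneg (by positivity) integral_gagSq_nonneg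
  have h2 : 0 ≤ ∫ x in Ω, u x ^ 2 := integral_sq_nonneg
  rw [HsNorm, ← Real.sqrt_eq_rpow, ← Real.sqrt_eq_rpow, two_mul]
  refine add_le_add (Real.sqrt_le_sqrt ?_) (Real.sqrt_le_sqrt ?_)
  · rw [hsSq]; linarith
  · rw [hsSq, seminormSq]; linarith

lemma HsNorm_nonneg (hc : 0 < c) : 0 ≤ HsNorm c s Ω u := by
  have h1 : 0 ≤ seminormSq c s Ω u := mul_nonneg (by positivity) integral_gagSq_nonneg
  have h2 : 0 ≤ ∫ x in Ω, u x ^ 2 := integral_sq_nonneg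
  unfold HsNorm
  positivity

lemma MemHs.l2E_le_hsSq (hc : 0 < c) (hu : MemHs s Ω u) :
    l2E Ω u ≤ ENNReal.ofReal (hsSq c s Ω u) := by
  rw [hu.l2E_eq]
  have h1 : 0 ≤ (c / 2) * ∫ p in crossSet Ω, gagSq s u p :=
    mul_nonneg (by positivity) integral_gagSq_nonneg
  exact ENNReal.ofReal_le_ofReal (by rw [hsSq]; linarith)

lemma MemHs.gagE_le_hsSq (hc : 0 < c) (hu : MemHs s Ω u) :
    gagE s Ω u ≤ ENNReal.ofReal (2 / c * hsSq c s Ω u) := by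
  rw [hu.gagE_eq]
  have h2 : 0 ≤ ∫ x in Ω, u x ^ 2 := integral_sq_nonneg
  refine ENNReal.ofReal_le_ofReal ?_
  rw [hsSq, mul_add]
  have h3 : 2 / c * (c / 2 * ∫ p in crossSet Ω, gagSq s u p) =
      ∫ p in crossSet Ω, gagSq s u p := by field_simp
  have h4 : 0 ≤ 2 / c * ∫ x in Ω, u x ^ 2 := by positivity
  linarith

lemma integrableOn_rpow_of_lintegral {l : ℝ} (hu : Measurable u)
    (h : ∫⁻ x in Ω, ENNReal.ofReal (|u x| ^ l) < ⊤) : IntegrableOn (fun x => |u x| ^ l) Ω :=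
  ⟨Measurable.aestronglyMeasurable (by fun_prop),
    (hasFiniteIntegral_iff_ofReal (ae_of_all _ fun x => by positivity)).2 h⟩

lemma integral_rpow_le_of_lintegral {l C : ℝ} (hC : 0 ≤ C) (hu : Measurable u)
    (h : ∫⁻ x in Ω, ENNReal.ofReal (|u x| ^ l) ≤ ENNReal.ofReal C) :
    ∫ x in Ω, |u x| ^ l ≤ C := by
  rw [integral_eq_lintegral_of_nonneg_ae (ae_of_all _ fun x => by positivity)
    (Measurable.aestronglyMeasurable (by fun_prop))]
  exact ENNReal.toReal_le_of_le_ofReal hC h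

lemma BoundedInLp.of_le {κ r₀ : ℝ} (hΩ : IsThick Ω κ r₀) {l q : ℝ} (hl : 0 < l) (hlq : l ≤ q)
    (h : BoundedInLp s Ω q) : BoundedInLp s Ω l := by
  intro A hA
  obtain ⟨C, hC, hCu⟩ := h A hA
  refine ⟨(volume Ω).toReal + C, by positivity, fun u hu h1 h2 => ?_⟩
  have hpt : ∀ x, ENNReal.ofReal (|u x| ^ l) ≤ 1 + ENNReal.ofReal (|u x| ^ q) := fun x => by
    rw [← ENNReal.ofReal_one, ← ENNReal.ofReal_add one_pos.le (by positivity)]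
    refine ENNReal.ofReal_le_ofReal ?_
    rcases le_or_gt |u x| 1 with hx | hx
    · have := Real.rpow_le_one (abs_nonneg _) hx hl.le
      have : 0 ≤ |u x| ^ q := by positivity
      linarith
    · have := Real.rpow_le_rpow_of_exponent_le hx.le hlq
      linarith
  calc ∫⁻ x in Ω, ENNReal.ofReal (|u x| ^ l)
      ≤ ∫⁻ x in Ω, (1 + ENNReal.ofReal (|u x| ^ q)) := lintegral_mono hpt
    _ = volume Ω + ∫⁻ x in Ω, ENNReal.ofReal (|u x| ^ q) := by
        rw [lintegral_add_left measurable_const]; simp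
    _ ≤ ENNReal.ofReal (volume Ω).toReal + ENNReal.ofReal C := by
        rw [ENNReal.ofReal_toReal hΩ.volume_lt_top.ne]
        gcongr
        exact hCu u hu h1 h2
    _ = _ := (ENNReal.ofReal_add (by positivity) hC.le).symm

lemma BoundedInLp.integrableOn {l : ℝ} (h : BoundedInLp s Ω l) (hu : MemHs s Ω u) :
    IntegrableOn (fun x => |u x| ^ l) Ω := by
  obtain ⟨C, -, hC⟩ := h ((∫ x in Ω, u x ^ 2) + (∫ p in crossSet Ω, gagSq s u p) + 1)
    (by linarith [integral_gagSq_nonneg (s := s) (Ω := Ω) (u := u),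
      integral_sq_nonneg (Ω := Ω) (u := u)])
  refine integrableOn_rpow_of_lintegral hu.1 ((hC u hu.1 ?_ ?_).trans_lt ENNReal.ofReal_lt_top)
  · rw [hu.l2E_eq]
    exact ENNReal.ofReal_le_ofReal (by linarith [integral_gagSq_nonneg (s := s) (Ω := Ω) (u := u)])
  · rw [hu.gagE_eq]
    exact ENNReal.ofReal_le_ofReal (by linarith [integral_sq_nonneg (Ω := Ω) (u := u)])

lemma rpow_le_interpolate {l q T a : ℝ} (hl : 2 < l) (hlq : l < q) (hT : 0 < T) (ha : 0 ≤ a) :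
    a ^ l ≤ T ^ (l - 2) * a ^ 2 + T ^ (l - q) * a ^ q := by
  rcases le_or_gt a T with h | h
  · have h1 : a ^ l = a ^ (l - 2) * a ^ 2 := by
      conv_lhs => rw [show l = l - 2 + 2 by ring]
      rw [Real.rpow_add' ha (by linarith), Real.rpow_two]
    have h2 : a ^ (l - 2) ≤ T ^ (l - 2) := Real.rpow_le_rpow ha h (by linarith)
    have h3 : 0 ≤ T ^ (l - q) * a ^ q := by positivity
    have h4 := mul_le_mul_of_nonneg_right h2 (sq_nonneg a)
    linarith
  · have hap : 0 < a := hT.trans h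
    have h1 : a ^ l = a ^ (l - q) * a ^ q := by
      rw [← Real.rpow_add hap]; ring_nf
    have h2 : a ^ (l - q) ≤ T ^ (l - q) :=
      Real.rpow_le_rpow_of_nonpos hT h.le (by linarith)
    have h3 : 0 ≤ T ^ (l - 2) * a ^ 2 := by positivity
    have h4 := mul_le_mul_of_nonneg_right h2 (by positivity : 0 ≤ a ^ q)
    linarith

lemma tendsto_integral_rpow {ι : Type*} {F : Filter ι} {w : ι → En n → ℝ} {l q C : ℝ}
    (hl : 2 < l) (hlq : l < q)
    (hw2 : ∀ i, IntegrableOn (fun x => w i x ^ 2) Ω)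
    (hwq : ∀ i, IntegrableOn (fun x => |w i x| ^ q) Ω)
    (hwl : ∀ i, IntegrableOn (fun x => |w i x| ^ l) Ω)
    (hbd : ∀ i, ∫ x in Ω, |w i x| ^ q ≤ C)
    (hlim : Tendsto (fun i => ∫ x in Ω, w i x ^ 2) F (nhds 0)) :
    Tendsto (fun i => ∫ x in Ω, |w i x| ^ l) F (nhds 0) := by
  have hest : ∀ T : ℝ, 0 < T → ∀ i, ∫ x in Ω, |w i x| ^ l ≤
      T ^ (l - 2) * (∫ x in Ω, w i x ^ 2) + T ^ (l - q) * C := by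
    intro T hT i
    calc ∫ x in Ω, |w i x| ^ l
        ≤ ∫ x in Ω, (T ^ (l - 2) * w i x ^ 2 + T ^ (l - q) * |w i x| ^ q) := by
          refine integral_mono (hwl i) (((hw2 i).const_mul _).add ((hwq i).const_mul _))
            fun x => ?_
          simpa using rpow_le_interpolate hl hlq hT (abs_nonneg (w i x))
      _ = T ^ (l - 2) * (∫ x in Ω, w i x ^ 2) + T ^ (l - q) * ∫ x in Ω, |w i x| ^ q := by
          rw [integral_add ((hw2 i).const_mul _) ((hwq i).const_mul _), integral_const_mul,
            integral_const_mul]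
      _ ≤ _ := by
          gcongr
          exact hbd i
  have hT0 : Tendsto (fun T : ℝ => T ^ (l - q) * C) atTop (nhds 0) := by
    have h1 := (tendsto_rpow_neg_atTop (by linarith : 0 < q - l)).mul_const C
    rw [zero_mul] at h1
    exact h1.congr fun T => by rw [neg_sub]
  refine tendsto_order.2 ⟨fun a ha => Eventually.of_forall fun i => ha.trans_le
    (integral_nonneg fun x => by positivity), fun ε hε => ?_⟩
  obtain ⟨T, hTε, hT⟩ := ((hT0.eventually_lt_const (half_pos hε)).and
    (eventually_gt_atTop 0)).exists
  have h1 := hlim.const_mul (T ^ (l - 2))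
  rw [mul_zero] at h1
  filter_upwards [h1.eventually_lt_const (half_pos hε)] with i hi
  exact (hest T hT i).trans_lt (by linarith)

lemma IsSubcritical.integrableOn_mul {f : ℝ → ℝ} {l C₀ κ r₀ : ℝ} (hf : IsSubcritical f l C₀)
    (hΩ : IsThick Ω κ r₀) (hl : BoundedInLp s Ω l) (hu : MemHs s Ω u) (hv : MemHs s Ω v) :
    IntegrableOn (fun x => f (u x) * v x) Ω := by
  have hc : IntegrableOn (fun _ : En n => (1 : ℝ)) Ω := integrableOn_const hΩ.volume_lt_top.ne
  have hb := (((hc.add (hv.2.1.div_const 1)).add ((hl.integrableOn hu).const_mul 1)).add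
    ((hl.integrableOn hv).const_mul (1 ^ (1 - l)))).const_mul C₀
  exact hb.mono' ((hf.measurable.comp hu.1).mul hv.1).aestronglyMeasurable
    (ae_of_all _ fun x => hf.abs_mul_le one_pos (u x) (v x))

lemma IsSubcritical.abs_integral_mul_le {f : ℝ → ℝ} {l C₀ κ r₀ δ : ℝ}
    (hf : IsSubcritical f l C₀) (hΩ : IsThick Ω κ r₀) (hl : BoundedInLp s Ω l)
    (hu : MemHs s Ω u) (hv : MemHs s Ω v) (hδ : 0 < δ) :
    |∫ x in Ω, f (u x) * v x| ≤ C₀ * (δ * (volume Ω).toReal + (∫ x in Ω, v x ^ 2) / δ +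
      δ * (∫ x in Ω, |u x| ^ l) + δ ^ (1 - l) * ∫ x in Ω, |v x| ^ l) := by
  have hc : IntegrableOn (fun _ : En n => δ) Ω := integrableOn_const hΩ.volume_lt_top.ne
  have i1 : IntegrableOn (fun x => δ + v x ^ 2 / δ) Ω := hc.add (hv.2.1.div_const δ)
  have i2 : IntegrableOn (fun x => δ + v x ^ 2 / δ + δ * |u x| ^ l) Ω :=
    i1.add ((hl.integrableOn hu).const_mul δ)
  have i3 := (hl.integrableOn hv).const_mul (δ ^ (1 - l))
  calc |∫ x in Ω, f (u x) * v x| ≤ ∫ x in Ω, |f (u x) * v x| := abs_integral_le_integral_abs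
    _ ≤ ∫ x in Ω, C₀ * (δ + v x ^ 2 / δ + δ * |u x| ^ l + δ ^ (1 - l) * |v x| ^ l) :=
        integral_mono (hf.integrableOn_mul hΩ hl hu hv).abs ((i2.add i3).const_mul C₀)
          fun x => hf.abs_mul_le hδ (u x) (v x)
    _ = _ := by
        rw [integral_const_mul, integral_add i2 i3,
          integral_add i1 ((hl.integrableOn hu).const_mul δ),
          integral_add hc (hv.2.1.div_const δ), integral_div, integral_const_mul,
          integral_const_mul, setIntegral_const, smul_eq_mul, mul_comm _ δ]
        rfl

lemma IsSubcritical.tendsto_integral_mul {ι : Type*} {F : Filter ι} {f : ℝ → ℝ}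
    {l C₀ κ r₀ M : ℝ} (hf : IsSubcritical f l C₀) (hΩ : IsThick Ω κ r₀)
    (hl : BoundedInLp s Ω l) {u w : ι → En n → ℝ} (hu : ∀ i, MemHs s Ω (u i))
    (hw : ∀ i, MemHs s Ω (w i)) (hM : ∀ i, ∫ x in Ω, |u i x| ^ l ≤ M)
    (hw2 : Tendsto (fun i => ∫ x in Ω, w i x ^ 2) F (nhds 0))
    (hwl : Tendsto (fun i => ∫ x in Ω, |w i x| ^ l) F (nhds 0)) :
    Tendsto (fun i => ∫ x in Ω, f (u i x) * w i x) F (nhds 0) := by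
  have hC := hf.C₀_pos
  rw [tendsto_zero_iff_abs_tendsto_zero]
  refine tendsto_order.2 ⟨fun a ha => Eventually.of_forall fun i => ha.trans_le (abs_nonneg _),
    fun ε hε => ?_⟩
  have hδ0 : Tendsto (fun δ : ℝ => C₀ * (δ * (volume Ω).toReal + δ * M)) (nhdsWithin 0 (Ioi 0))
      (nhds 0) := by
    have : Continuous fun δ : ℝ => C₀ * (δ * (volume Ω).toReal + δ * M) := by fun_prop
    exact (this.tendsto' 0 0 (by simp)).mono_left nhdsWithin_le_nhds
  obtain ⟨δ, hδε, hδ⟩ := ((hδ0.eventually_lt_const (half_pos hε)).and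
    self_mem_nhdsWithin).exists
  have hδ : 0 < δ := hδ
  have h1 := ((hw2.div_const δ).add (hwl.const_mul (δ ^ (1 - l)))).const_mul C₀
  rw [zero_div, mul_zero, add_zero, mul_zero] at h1
  filter_upwards [h1.eventually_lt_const (half_pos hε)] with i hi
  refine (hf.abs_integral_mul_le hΩ hl (hu i) (hw i) hδ).trans_lt ?_
  have h2 : C₀ * (δ * ∫ x in Ω, |u i x| ^ l) ≤ C₀ * (δ * M) := by
    gcongr
    exact hM i
  linarith

end HsSpace

section Completeness

variable {n : ℕ} {s : ℝ} {Ω : Set (En n)}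

lemma IsThick.volume_pos {κ r₀ : ℝ} (hΩ : IsThick Ω κ r₀) : 0 < volume Ω := by
  obtain ⟨x, hx⟩ := hΩ.nonempty
  have hκ := hΩ.κ_pos
  have hr₀ := hΩ.r₀_pos
  calc (0 : ENNReal) < ENNReal.ofReal (κ * r₀ ^ n) := ENNReal.ofReal_pos.2 (by positivity)
    _ ≤ volume (Ω ∩ Metric.ball x r₀) := hΩ.density x hx r₀ hr₀ le_rfl
    _ ≤ volume Ω := measure_mono inter_subset_left

/-- The decaying weight for which `H^s_{Ω,0}` embeds into a weighted `L²(ℝⁿ)`. -/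
def tailWeight {n : ℕ} (s : ℝ) (y : En n) : ENNReal :=
  ENNReal.ofReal ((1 + ‖y‖) ^ (-((n : ℝ) + 2 * s)))

lemma measurable_tailWeight : Measurable (tailWeight s : En n → ENNReal) := by
  unfold tailWeight
  fun_prop

lemma tailWeight_ne_zero (y : En n) : tailWeight s y ≠ 0 :=
  (ENNReal.ofReal_pos.2 (Real.rpow_pos_of_pos (by positivity) _)).ne'

lemma lintegral_tailWeight_lt_top (hs : 0 < s) : ∫⁻ y : En n, tailWeight s y < ⊤ :=
  finite_integral_one_add_norm (by rw [finrank_euclideanSpace_fin]; linarith)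

lemma sq_mul_tailWeight_le (hs : 0 < s) {ρ : ℝ} (hρ : 0 ≤ ρ) (w : En n → ℝ) {x : En n}
    (hx : ‖x‖ ≤ ρ) (y : En n) :
    ENNReal.ofReal (w y ^ 2) * tailWeight s y ≤
      2 * (ENNReal.ofReal (w x ^ 2) * tailWeight s y) +
        ENNReal.ofReal (2 * (1 + ρ) ^ ((n : ℝ) + 2 * s)) * ENNReal.ofReal (gagSq s w (x, y)) := by
  set b : ℝ := (n : ℝ) + 2 * s
  have hy : 0 < 1 + ‖y‖ := by positivity
  have hd : dist x y ≤ (1 + ρ) * (1 + ‖y‖) := by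
    have h1 := norm_sub_le x y
    have h2 : 0 ≤ ρ * ‖y‖ := by positivity
    rw [dist_eq_norm]
    nlinarith
  have h1 := sq_sub_le_gagSq hs (u := w) hd
  rw [Real.mul_rpow (by positivity) hy.le] at h1
  have h2 : w y ^ 2 ≤ 2 * w x ^ 2 + 2 * (w x - w y) ^ 2 := by
    nlinarith [sq_nonneg (2 * w x - w y)]
  have hg : 0 ≤ (1 + ‖y‖) ^ (-b) := by positivity
  have h3 : (1 + ‖y‖) ^ b * (1 + ‖y‖) ^ (-b) = 1 := by
    rw [← Real.rpow_add hy, add_neg_cancel, Real.rpow_zero]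
  have h4 := gagSq_nonneg s w (x, y)
  unfold tailWeight
  rw [← ENNReal.ofReal_mul (sq_nonneg _), ← ENNReal.ofReal_mul (sq_nonneg _),
    show (2 : ENNReal) * ENNReal.ofReal (w x ^ 2 * (1 + ‖y‖) ^ (-((n : ℝ) + 2 * s))) =
      ENNReal.ofReal (2 * (w x ^ 2 * (1 + ‖y‖) ^ (-((n : ℝ) + 2 * s)))) by
        rw [ENNReal.ofReal_mul zero_le_two, ENNReal.ofReal_ofNat],
    ← ENNReal.ofReal_mul (by positivity), ← ENNReal.ofReal_add (by positivity) (by positivity)]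
  refine ENNReal.ofReal_le_ofReal ?_
  calc w y ^ 2 * (1 + ‖y‖) ^ (-b)
      ≤ (2 * w x ^ 2 + 2 * ((1 + ρ) ^ b * (1 + ‖y‖) ^ b * gagSq s w (x, y))) *
          (1 + ‖y‖) ^ (-b) := mul_le_mul_of_nonneg_right (by linarith) hg
    _ = 2 * (w x ^ 2 * (1 + ‖y‖) ^ (-b)) + 2 * (1 + ρ) ^ b * gagSq s w (x, y) *
          ((1 + ‖y‖) ^ b * (1 + ‖y‖) ^ (-b)) := by ring
    _ = _ := by rw [h3]; ring

lemma exists_weighted_bound {κ r₀ : ℝ} (hs : 0 < s) (hΩ : IsThick Ω κ r₀) :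
    ∃ D : ENNReal, D ≠ ⊤ ∧ ∀ w : En n → ℝ, Measurable w →
      ∫⁻ y, tailWeight s y * ENNReal.ofReal (w y ^ 2) ≤ D * (l2E Ω w + gagE s Ω w) := by
  obtain ⟨ρ, hρ⟩ := hΩ.isBounded.exists_norm_le
  obtain ⟨x₀, hx₀⟩ := hΩ.nonempty
  have hρ0 : 0 ≤ ρ := (norm_nonneg x₀).trans (hρ x₀ hx₀)
  set G : ENNReal := ∫⁻ y : En n, tailWeight s y
  set K : ENNReal := ENNReal.ofReal (2 * (1 + ρ) ^ ((n : ℝ) + 2 * s))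
  have hG : G ≠ ⊤ := (lintegral_tailWeight_lt_top hs).ne
  refine ⟨(volume Ω)⁻¹ * (2 * G + K), ENNReal.mul_ne_top
    (ENNReal.inv_ne_top.2 hΩ.volume_pos.ne') (by finiteness), fun w hw => ?_⟩
  have hgm : Measurable fun p => ENNReal.ofReal (gagSq s w p) :=
    (measurable_gagSq hw).ennreal_ofReal
  have hgx : ∀ x, Measurable fun y => ENNReal.ofReal (gagSq s w (x, y)) :=
    fun x => hgm.comp measurable_prodMk_left
  set I : ENNReal := ∫⁻ y, tailWeight s y * ENNReal.ofReal (w y ^ 2)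
  have hx : ∀ x ∈ Ω, I ≤ 2 * G * ENNReal.ofReal (w x ^ 2) +
      K * ∫⁻ y, ENNReal.ofReal (gagSq s w (x, y)) := by
    intro x hx
    calc I ≤ ∫⁻ y, (2 * ENNReal.ofReal (w x ^ 2) * tailWeight s y +
          K * ENNReal.ofReal (gagSq s w (x, y))) := by
          refine lintegral_mono fun y => ?_
          rw [mul_comm (tailWeight s y), mul_assoc]
          exact sq_mul_tailWeight_le hs hρ0 w (hρ x hx) y
      _ = 2 * ENNReal.ofReal (w x ^ 2) * G + K * ∫⁻ y, ENNReal.ofReal (gagSq s w (x, y)) := by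
          rw [lintegral_add_left (measurable_tailWeight.const_mul _),
            lintegral_const_mul _ measurable_tailWeight,
            lintegral_const_mul K (hgx x)]
      _ = _ := by ring
  have hint : volume Ω * I ≤ (2 * G + K) * (l2E Ω w + gagE s Ω w) := by
    calc volume Ω * I = ∫⁻ _ in Ω, I := by rw [setLIntegral_const, mul_comm]
      _ ≤ ∫⁻ x in Ω, (2 * G * ENNReal.ofReal (w x ^ 2) +
          K * ∫⁻ y, ENNReal.ofReal (gagSq s w (x, y))) :=
          setLIntegral_mono' hΩ.measurableSet hx
      _ = 2 * G * l2E Ω w + K * ∫⁻ x in Ω, ∫⁻ y, ENNReal.ofReal (gagSq s w (x, y)) := by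
          rw [lintegral_add_left (by fun_prop), lintegral_const_mul _ (by fun_prop),
            lintegral_const_mul _ hgm.lintegral_prod_right', l2E]
      _ ≤ 2 * G * l2E Ω w + K * gagE s Ω w := by
          refine add_le_add le_rfl (mul_le_mul_right ?_ K)
          rw [← lintegral_prod _ hgm.aemeasurable, Measure.restrict_prod_eq_prod_univ]
          exact lintegral_mono_set fun p hp => Or.inl hp.1
      _ ≤ (2 * G + K) * l2E Ω w + (2 * G + K) * gagE s Ω w :=
          add_le_add (mul_le_mul_left le_self_add _) (mul_le_mul_left le_add_self _)
      _ = _ := (mul_add _ _ _).symm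
  calc I = (volume Ω)⁻¹ * (volume Ω * I) := by
        rw [← mul_assoc, ENNReal.inv_mul_cancel hΩ.volume_pos.ne' hΩ.volume_lt_top.ne, one_mul]
    _ ≤ (volume Ω)⁻¹ * ((2 * G + K) * (l2E Ω w + gagE s Ω w)) := mul_le_mul_right hint _
    _ = _ := (mul_assoc _ _ _).symm

lemma exists_subseq_ae_tendsto {κ r₀ : ℝ} (hs : 0 < s) (hΩ : IsThick Ω κ r₀)
    {u : ℕ → En n → ℝ} (hu : ∀ k, Measurable (u k))
    (hL : Tendsto (fun p : ℕ × ℕ => l2E Ω (fun x => u p.1 x - u p.2 x)) atTop (nhds 0))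
    (hG : Tendsto (fun p : ℕ × ℕ => gagE s Ω (fun x => u p.1 x - u p.2 x)) atTop (nhds 0)) :
    ∃ (v : En n → ℝ) (ψ : ℕ → ℕ), Measurable v ∧ StrictMono ψ ∧
      ∀ᵐ y, Tendsto (fun k => u (ψ k) y) atTop (nhds (v y)) := by
  obtain ⟨D, hD, hDw⟩ := exists_weighted_bound hs hΩ
  set ν : Measure (En n) := volume.withDensity (tailWeight s)
  have hν : (volume : Measure (En n)) ≪ ν :=
    withDensity_absolutelyContinuous' measurable_tailWeight.aemeasurable
      (ae_of_all _ tailWeight_ne_zero)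
  have hnorm : ∀ p : ℕ × ℕ, eLpNorm' (u p.1 - u p.2) 2 ν ≤
      (D * (l2E Ω (fun x => u p.1 x - u p.2 x) +
        gagE s Ω (fun x => u p.1 x - u p.2 x))) ^ (1 / 2 : ℝ) := by
    intro p
    unfold eLpNorm'
    refine ENNReal.rpow_le_rpow ?_ (by norm_num)
    refine le_trans (le_of_eq ?_) (hDw _ ((hu p.1).sub (hu p.2)))
    rw [lintegral_withDensity_eq_lintegral_mul _ measurable_tailWeight
      (((hu p.1).sub (hu p.2)).enorm.pow_const _)]
    refine lintegral_congr fun y => ?_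
    rw [Pi.mul_apply, Pi.sub_apply, Real.enorm_eq_ofReal_abs, ENNReal.rpow_two,
      ← ENNReal.ofReal_pow (abs_nonneg _), sq_abs]
  have hlim : Tendsto (fun p : ℕ × ℕ => eLpNorm' (u p.1 - u p.2) 2 ν) atTop (nhds 0) := by
    refine tendsto_of_tendsto_of_tendsto_of_le_of_le tendsto_const_nhds ?_
      (fun _ => zero_le) hnorm
    have h1 := ENNReal.Tendsto.const_mul (hL.add hG) (Or.inr hD)
    rw [add_zero, mul_zero] at h1
    have h2 := (ENNReal.continuous_rpow_const (y := (1 / 2 : ℝ))).tendsto 0 |>.comp h1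
    rwa [ENNReal.zero_rpow_of_pos (by norm_num)] at h2
  set B : ℕ → ENNReal := fun N => 2⁻¹ ^ N
  have hBpos : ∀ N, 0 < B N := fun N => ENNReal.pow_pos (by simp) N
  obtain ⟨ψ, hψ, hψB⟩ := extraction_forall_of_eventually'
    (P := fun N k => ∀ a ≥ k, ∀ b ≥ k, eLpNorm' (u a - u b) 2 ν < B N) fun N => by
      obtain ⟨K, hK⟩ := eventually_atTop_prod_self'.1 (hlim.eventually_lt_const (hBpos N))
      exact ⟨K, fun k hk a ha b hb => hK a (hk.trans ha) b (hk.trans hb)⟩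
  have hae := hν.ae_le (Lp.ae_tendsto_of_cauchy_eLpNorm' (μ := ν) (f := fun k => u (ψ k))
    (fun k => (hu _).aestronglyMeasurable) (by norm_num : (1 : ℝ) ≤ 2) (B := B)
    (by rw [ENNReal.tsum_geometric]; simp) fun N a b ha hb =>
      hψB N _ (hψ.monotone ha) _ (hψ.monotone hb))
  obtain ⟨v, hv, hlim⟩ := measurable_limit_of_tendsto_metrizable_ae
    (fun k => (hu (ψ k)).aemeasurable) hae
  exact ⟨v, ψ, hv, hψ, hlim⟩

lemma lintegral_le_of_ae_tendsto {α : Type*} [MeasurableSpace α] {μ : Measure α}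
    {f : ℕ → α → ENNReal} {g : α → ENNReal} {a : ENNReal} (hf : ∀ k, Measurable (f k))
    (hlim : ∀ᵐ x ∂μ, Tendsto (fun k => f k x) atTop (nhds (g x)))
    (ha : ∀ᶠ k in atTop, ∫⁻ x, f k x ∂μ ≤ a) : ∫⁻ x, g x ∂μ ≤ a :=
  calc ∫⁻ x, g x ∂μ = ∫⁻ x, liminf (fun k => f k x) atTop ∂μ :=
        lintegral_congr_ae (hlim.mono fun _ hx => hx.liminf_eq.symm)
    _ ≤ liminf (fun k => ∫⁻ x, f k x ∂μ) atTop := lintegral_liminf_le hf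
    _ ≤ a := liminf_le_of_frequently_le' ha.frequently

lemma l2E_le_of_ae_tendsto {w : ℕ → En n → ℝ} {v : En n → ℝ} {a : ENNReal}
    (hw : ∀ k, Measurable (w k)) (hlim : ∀ᵐ y, Tendsto (fun k => w k y) atTop (nhds (v y)))
    (ha : ∀ᶠ k in atTop, l2E Ω (w k) ≤ a) : l2E Ω v ≤ a :=
  lintegral_le_of_ae_tendsto (fun k => ((hw k).pow_const 2).ennreal_ofReal)
    (ae_restrict_of_ae (hlim.mono fun _ hy => ENNReal.tendsto_ofReal (hy.pow 2))) ha

lemma gagE_le_of_ae_tendsto {w : ℕ → En n → ℝ} {v : En n → ℝ} {a : ENNReal}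
    (hw : ∀ k, Measurable (w k)) (hlim : ∀ᵐ y, Tendsto (fun k => w k y) atTop (nhds (v y)))
    (ha : ∀ᶠ k in atTop, gagE s Ω (w k) ≤ a) : gagE s Ω v ≤ a := by
  refine lintegral_le_of_ae_tendsto (fun k => (measurable_gagSq (hw k)).ennreal_ofReal)
    (ae_restrict_of_ae ?_) ha
  have h1 : ∀ᵐ p : En n × En n, Tendsto (fun k => w k p.1) atTop (nhds (v p.1)) :=
    Measure.quasiMeasurePreserving_fst.ae hlim
  have h2 : ∀ᵐ p : En n × En n, Tendsto (fun k => w k p.2) atTop (nhds (v p.2)) :=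
    Measure.quasiMeasurePreserving_snd.ae hlim
  filter_upwards [h1, h2] with p hp1 hp2
  exact ENNReal.tendsto_ofReal ((((hp1.sub hp2).abs).pow 2).div_const _)

lemma exists_limit_of_cauchy {κ r₀ c : ℝ} (hs : 0 < s) (hΩ : IsThick Ω κ r₀)
    {u : ℕ → En n → ℝ} (hu : ∀ k, MemHs s Ω (u k))
    (hL : Tendsto (fun p : ℕ × ℕ => l2E Ω (fun x => u p.1 x - u p.2 x)) atTop (nhds 0))
    (hG : Tendsto (fun p : ℕ × ℕ => gagE s Ω (fun x => u p.1 x - u p.2 x)) atTop (nhds 0)) :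
    ∃ (v : En n → ℝ) (ψ : ℕ → ℕ), MemHs s Ω v ∧ StrictMono ψ ∧
      Tendsto (fun k => HsNorm c s Ω (fun x => u (ψ k) x - v x)) atTop (nhds 0) := by
  obtain ⟨v, ψ, hv, hψ, hlim⟩ := exists_subseq_ae_tendsto hs hΩ (fun k => (hu k).1) hL hG
  have hd : ∀ k, ∀ᵐ y, Tendsto (fun j => u (ψ k) y - u (ψ j) y) atTop
      (nhds (u (ψ k) y - v y)) := fun k => hlim.mono fun y hy => hy.const_sub _
  have hdm : ∀ k j, Measurable fun y => u (ψ k) y - u (ψ j) y :=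
    fun k j => (hu _).1.sub (hu _).1
  have hL0 : Tendsto (fun k => l2E Ω (fun x => u (ψ k) x - v x)) atTop (nhds 0) := by
    refine ENNReal.tendsto_nhds_zero.2 fun ε hε => ?_
    obtain ⟨N, hN⟩ := eventually_atTop_prod_self'.1 (hL.eventually_le_const hε)
    filter_upwards [eventually_ge_atTop N] with k hk
    refine l2E_le_of_ae_tendsto (hdm k) (hd k) ?_
    filter_upwards [eventually_ge_atTop N] with j hj
    exact hN _ (hk.trans (hψ.id_le k)) _ (hj.trans (hψ.id_le j))
  have hG0 : Tendsto (fun k => gagE s Ω (fun x => u (ψ k) x - v x)) atTop (nhds 0) := by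
    refine ENNReal.tendsto_nhds_zero.2 fun ε hε => ?_
    obtain ⟨N, hN⟩ := eventually_atTop_prod_self'.1 (hG.eventually_le_const hε)
    filter_upwards [eventually_ge_atTop N] with k hk
    refine gagE_le_of_ae_tendsto (hdm k) (hd k) ?_
    filter_upwards [eventually_ge_atTop N] with j hj
    exact hN _ (hk.trans (hψ.id_le k)) _ (hj.trans (hψ.id_le j))
  have hmem : MemHs s Ω v := by
    obtain ⟨k, hk1, hk2⟩ := ((hL0.eventually_lt_const ENNReal.zero_lt_top).and
      (hG0.eventually_lt_const ENNReal.zero_lt_top)).exists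
    have h1 : MemHs s Ω fun x => u (ψ k) x - v x := memHs_iff.2 ⟨(hu _).1.sub hv, hk1, hk2⟩
    simpa using (hu (ψ k)).sub h1
  refine ⟨v, ψ, hmem, hψ, ?_⟩
  have hL1 : Tendsto (fun k => ∫ x in Ω, (u (ψ k) x - v x) ^ 2) atTop (nhds 0) := by
    have h := (ENNReal.tendsto_toReal ENNReal.zero_ne_top).comp hL0
    refine h.congr fun k => ?_
    rw [Function.comp_apply, ((hu (ψ k)).sub hmem).l2E_eq, ENNReal.toReal_ofReal
      integral_sq_nonneg]
  have hG1 : Tendsto (fun k => ∫ p in crossSet Ω, gagSq s (fun x => u (ψ k) x - v x) p)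
      atTop (nhds 0) := by
    have h := (ENNReal.tendsto_toReal ENNReal.zero_ne_top).comp hG0
    refine h.congr fun k => ?_
    rw [Function.comp_apply, ((hu (ψ k)).sub hmem).gagE_eq, ENNReal.toReal_ofReal
      integral_gagSq_nonneg]
  have h1 := (hL1.rpow_const (p := (1 / 2 : ℝ)) (Or.inr (by norm_num))).add
    ((hG1.const_mul (c / 2)).rpow_const (p := (1 / 2 : ℝ)) (Or.inr (by norm_num)))
  rw [mul_zero, Real.zero_rpow (by norm_num), add_zero] at h1
  exact h1

end Completeness

section PalaisSmale

variable {n : ℕ} {s c : ℝ} {Ω : Set (En n)} {f : ℝ → ℝ} {u v : En n → ℝ}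

lemma measurable_of_continuousOn_Ici (hf : ContinuousOn f (Ici 0)) (h0 : ∀ t < (0 : ℝ), f t = 0) :
    Measurable f := by
  classical
  have h1 : f = (Ici (0 : ℝ)).piecewise f 0 := by
    ext t
    by_cases ht : t ∈ Ici (0 : ℝ)
    · rw [piecewise_eq_of_mem _ _ _ ht]
    · rw [piecewise_eq_of_notMem _ _ _ ht, h0 t (not_le.1 ht), Pi.zero_apply]
  rw [h1]
  exact hf.measurable_piecewise continuousOn_const measurableSet_Ici

lemma energy_eq : energy c s Ω f u = hsSq c s Ω u / 2 - ∫ x in Ω, ∫ τ in (0 : ℝ)..u x, f τ := by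
  rw [energy, hsSq]
  ring

lemma Eprime_self : Eprime c s Ω f u u = hsSq c s Ω u - ∫ x in Ω, f (u x) * u x := by
  have h1 : gagBil s u u = gagSq s u := by
    ext p
    rw [gagBil, gagSq, sq_abs, sq]
  have h2 : (fun x => u x * u x) = fun x => u x ^ 2 := by
    ext x
    rw [sq]
  rw [Eprime, hsSq, h1, h2]

lemma Eprime_sub (hu : MemHs s Ω u) (hv : MemHs s Ω v) :
    Eprime c s Ω f u (fun x => u x - v x) - Eprime c s Ω f v (fun x => u x - v x) =
      hsSq c s Ω (fun x => u x - v x) - (∫ x in Ω, f (u x) * (u x - v x)) +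
        ∫ x in Ω, f (v x) * (u x - v x) := by
  have hw := hu.sub hv
  have h1 : ∫ p in crossSet Ω, gagSq s (fun x => u x - v x) p =
      (∫ p in crossSet Ω, gagBil s u (fun x => u x - v x) p) -
        ∫ p in crossSet Ω, gagBil s v (fun x => u x - v x) p := by
    rw [← integral_sub (hu.integrableOn_gagBil hw) (hv.integrableOn_gagBil hw)]
    refine integral_congr_ae (ae_of_all _ fun p => ?_)
    simp only [gagSq, gagBil, sq_abs]
    ring
  have h2 : ∫ x in Ω, (u x - v x) ^ 2 =
      (∫ x in Ω, u x * (u x - v x)) - ∫ x in Ω, v x * (u x - v x) := by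
    rw [← integral_sub (hu.integrableOn_mul hw) (hv.integrableOn_mul hw)]
    refine integral_congr_ae (ae_of_all _ fun x => ?_)
    ring
  rw [Eprime, Eprime, hsSq, h1, h2]
  ring

lemma IsSubcritical.exists_coercive {l C₀ κ r₀ : ℝ} (hf : IsSubcritical f l C₀)
    (hΩ : IsThick Ω κ r₀) (hl : BoundedInLp s Ω l) :
    ∃ a μ b : ℝ, 0 < a ∧ 0 < μ ∧ ∀ u : En n → ℝ, MemHs s Ω u →
      a * hsSq c s Ω u ≤ energy c s Ω f u - Eprime c s Ω f u u / μ + b := by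
  obtain ⟨μ, C, hμ, hC, hAR⟩ := hf.exists_ambrosetti_rabinowitz
  have hμ0 : 0 < μ := by linarith
  refine ⟨1 / 2 - 1 / μ, μ, C * (volume Ω).toReal / μ,
    sub_pos.2 (one_div_lt_one_div_of_lt two_pos hμ), hμ0, fun u hu => ?_⟩
  have hci : IntegrableOn (fun _ : En n => C) Ω := integrableOn_const hΩ.volume_lt_top.ne
  have hfu := hf.integrableOn_mul hΩ hl hu hu
  have hdom : IntegrableOn (fun x => (f (u x) * u x + C) / μ) Ω := (hfu.add hci).div_const μ
  have hle : ∀ x, ∫ τ in (0 : ℝ)..u x, f τ ≤ (f (u x) * u x + C) / μ := fun x => by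
    rw [le_div_iff₀' hμ0]
    exact hAR (u x)
  have hF : IntegrableOn (fun x => ∫ τ in (0 : ℝ)..u x, f τ) Ω := by
    refine hdom.mono' (hf.continuous_primitive.measurable.comp hu.1).aestronglyMeasurable
      (ae_of_all _ fun x => ?_)
    rw [Real.norm_eq_abs, abs_of_nonneg (hf.primitive_nonneg _)]
    exact hle x
  have h1 : ∫ x in Ω, (∫ τ in (0 : ℝ)..u x, f τ) ≤
      ((∫ x in Ω, f (u x) * u x) + C * (volume Ω).toReal) / μ := by
    refine (integral_mono hF hdom hle).trans_eq ?_
    rw [integral_div, integral_add hfu hci, setIntegral_const, smul_eq_mul, mul_comm C]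
    rfl
  rw [energy_eq, Eprime_self]
  have h2 : (1 / 2 - 1 / μ) * hsSq c s Ω u = hsSq c s Ω u / 2 - hsSq c s Ω u / μ := by ring
  rw [h2, sub_div]
  rw [add_div] at h1
  linarith

lemma sq_le_of_mul_sq_le {a P Q y : ℝ} (ha : 0 < a) (h : a * y ^ 2 ≤ P + Q * y) :
    y ^ 2 ≤ 2 / a * (P + Q ^ 2 / (2 * a)) := by
  have h1 : Q * y ≤ a * y ^ 2 / 2 + Q ^ 2 / (2 * a) := by
    have h2 : a * y ^ 2 / 2 + Q ^ 2 / (2 * a) - Q * y = (a * y - Q) ^ 2 / (2 * a) := by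
      field_simp
      ring
    have h3 : 0 ≤ (a * y - Q) ^ 2 / (2 * a) := by positivity
    linarith
  rw [div_mul_eq_mul_div, le_div_iff₀ ha]
  linarith

/-- Palais–Smale sequences are bounded. -/
lemma IsSubcritical.exists_hsSq_le {l C₀ κ r₀ B M : ℝ} (hf : IsSubcritical f l C₀)
    (hΩ : IsThick Ω κ r₀) (hl : BoundedInLp s Ω l) (hc : 0 < c) {u : ℕ → En n → ℝ}
    (hu : ∀ k, MemHs s Ω (u k)) (hE : ∀ k, |energy c s Ω f (u k)| ≤ B)
    (hE' : ∀ k, |Eprime c s Ω f (u k) (u k)| ≤ M * HsNorm c s Ω (u k)) (hM : 0 ≤ M) :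
    ∃ A : ℝ, 0 < A ∧ ∀ k, hsSq c s Ω (u k) ≤ A := by
  obtain ⟨a, μ, b, ha, hμ, hab⟩ := hf.exists_coercive (c := c) hΩ hl
  set Q : ℝ := M * 2 / μ
  refine ⟨max 1 (2 / a * (B + b + Q ^ 2 / (2 * a))), lt_max_of_lt_left one_pos,
    fun k => le_max_of_le_right ?_⟩
  have h0 : 0 ≤ hsSq c s Ω (u k) := hsSq_nonneg hc
  rw [← Real.sq_sqrt h0]
  refine sq_le_of_mul_sq_le ha ?_
  rw [Real.sq_sqrt h0]
  have h1 := hab (u k) (hu k)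
  have h2 : -(Eprime c s Ω f (u k) (u k)) / μ ≤ Q * √(hsSq c s Ω (u k)) := by
    rw [div_le_iff₀ hμ]
    calc -(Eprime c s Ω f (u k) (u k)) ≤ M * HsNorm c s Ω (u k) :=
          (neg_le_abs _).trans (hE' k)
      _ ≤ M * (2 * √(hsSq c s Ω (u k))) := mul_le_mul_of_nonneg_left (HsNorm_le hc) hM
      _ = Q * √(hsSq c s Ω (u k)) * μ := by
          simp only [Q]
          field_simp
  rw [neg_div] at h2
  linarith [(le_abs_self _).trans (hE k)]

lemma tendsto_fst_atTop : Tendsto (Prod.fst : ℕ × ℕ → ℕ) atTop atTop := by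
  rw [← prod_atTop_atTop_eq]
  exact tendsto_fst

lemma tendsto_snd_atTop : Tendsto (Prod.snd : ℕ × ℕ → ℕ) atTop atTop := by
  rw [← prod_atTop_atTop_eq]
  exact tendsto_snd

/-- Bounded Palais–Smale sequences that are Cauchy in `L²(Ω)` are Cauchy in `H^s_{Ω,0}`. -/
lemma IsSubcritical.tendsto_hsSq_sub {l q C₀ κ r₀ A : ℝ} (hf : IsSubcritical f l C₀)
    (hΩ : IsThick Ω κ r₀) (hlq : l < q) (hq : BoundedInLp s Ω q) (hc : 0 < c) (hA : 0 < A)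
    {u : ℕ → En n → ℝ} (hu : ∀ k, MemHs s Ω (u k)) (huA : ∀ k, hsSq c s Ω (u k) ≤ A)
    {ε : ℕ → ℝ} (hε : Tendsto ε atTop (nhds 0))
    (hE' : ∀ k v, MemHs s Ω v → |Eprime c s Ω f (u k) v| ≤ ε k * HsNorm c s Ω v)
    (hL : Tendsto (fun p : ℕ × ℕ => l2E Ω (fun x => u p.1 x - u p.2 x)) atTop (nhds 0)) :
    Tendsto (fun p : ℕ × ℕ => hsSq c s Ω (fun x => u p.1 x - u p.2 x)) atTop (nhds 0) := by
  have hl2 := hf.two_lt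
  have hl := hq.of_le hΩ (by linarith) hlq.le
  have hw : ∀ p : ℕ × ℕ, MemHs s Ω (fun x => u p.1 x - u p.2 x) := fun p => (hu _).sub (hu _)
  set A' : ℝ := A + 2 / c * A
  have hA' : 0 < A' := by positivity
  have huL : ∀ k, l2E Ω (u k) ≤ ENNReal.ofReal A' := fun k =>
    ((hu k).l2E_le_hsSq hc).trans (ENNReal.ofReal_le_ofReal
      ((huA k).trans (le_add_of_nonneg_right (by positivity))))
  have huG : ∀ k, gagE s Ω (u k) ≤ ENNReal.ofReal A' := fun k =>
    ((hu k).gagE_le_hsSq hc).trans (ENNReal.ofReal_le_ofReal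
      ((mul_le_mul_of_nonneg_left (huA k) (by positivity)).trans
        (le_add_of_nonneg_left hA.le)))
  have h4 : ∀ a b : ENNReal, a ≤ ENNReal.ofReal A' → b ≤ ENNReal.ofReal A' →
      2 * (a + b) ≤ ENNReal.ofReal (4 * A') := fun a b ha hb => by
    calc 2 * (a + b) ≤ 2 * (ENNReal.ofReal A' + ENNReal.ofReal A') := by gcongr
      _ = ENNReal.ofReal (4 * A') := by
        rw [ENNReal.ofReal_mul zero_le_four, ENNReal.ofReal_ofNat]
        ring
  have hwL : ∀ p : ℕ × ℕ, l2E Ω (fun x => u p.1 x - u p.2 x) ≤ ENNReal.ofReal (4 * A') :=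
    fun p => (l2E_sub_le (hu _).1 (hu _).1).trans (h4 _ _ (huL _) (huL _))
  have hwG : ∀ p : ℕ × ℕ, gagE s Ω (fun x => u p.1 x - u p.2 x) ≤ ENNReal.ofReal (4 * A') :=
    fun p => (gagE_sub_le (hu _).1 (hu _).1).trans (h4 _ _ (huG _) (huG _))
  have hw2 : Tendsto (fun p : ℕ × ℕ => ∫ x in Ω, (u p.1 x - u p.2 x) ^ 2) atTop (nhds 0) := by
    refine ((ENNReal.tendsto_toReal ENNReal.zero_ne_top).comp hL).congr fun p => ?_
    rw [Function.comp_apply, (hw p).l2E_eq, ENNReal.toReal_ofReal integral_sq_nonneg]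
  obtain ⟨Cq, hCq, hqC⟩ := hq (4 * A') (by positivity)
  have hwl : Tendsto (fun p : ℕ × ℕ => ∫ x in Ω, |u p.1 x - u p.2 x| ^ l) atTop (nhds 0) :=
    tendsto_integral_rpow hl2 hlq (fun p => (hw p).2.1) (fun p => hq.integrableOn (hw p))
      (fun p => hl.integrableOn (hw p)) (fun p => integral_rpow_le_of_lintegral hCq.le (hw p).1
        (hqC _ (hw p).1 (hwL p) (hwG p))) hw2
  obtain ⟨Cl, hCl, hlC⟩ := hl A' hA'
  have hul : ∀ k, ∫ x in Ω, |u k x| ^ l ≤ Cl := fun k =>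
    integral_rpow_le_of_lintegral hCl.le (hu k).1 (hlC _ (hu k).1 (huL k) (huG k))
  have hN1 := hf.tendsto_integral_mul hΩ hl (fun p : ℕ × ℕ => hu p.1) hw (fun p => hul p.1)
    hw2 hwl
  have hN2 := hf.tendsto_integral_mul hΩ hl (fun p : ℕ × ℕ => hu p.2) hw (fun p => hul p.2)
    hw2 hwl
  set K : ℝ := 2 * √(4 * A' + c / 2 * (4 * A'))
  have hwK : ∀ p : ℕ × ℕ, HsNorm c s Ω (fun x => u p.1 x - u p.2 x) ≤ K := fun p => by
    refine (HsNorm_le hc).trans (mul_le_mul_of_nonneg_left (Real.sqrt_le_sqrt ?_) zero_le_two)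
    have h1 := hwL p
    have h2 := hwG p
    rw [(hw p).l2E_eq, ENNReal.ofReal_le_ofReal_iff (by positivity)] at h1
    rw [(hw p).gagE_eq, ENNReal.ofReal_le_ofReal_iff (by positivity)] at h2
    rw [hsSq]
    linarith [mul_le_mul_of_nonneg_left h2 (by positivity : 0 ≤ c / 2)]
  have hEp : ∀ k (p : ℕ × ℕ), |Eprime c s Ω f (u k) (fun x => u p.1 x - u p.2 x)| ≤ |ε k| * K :=
    fun k p => (hE' k _ (hw p)).trans (mul_le_mul (le_abs_self _) (hwK p) (HsNorm_nonneg hc)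
      (abs_nonneg _))
  have hεK : Tendsto (fun k => |ε k| * K) atTop (nhds 0) := by
    simpa using hε.abs.mul_const K
  have hE1 : Tendsto (fun p : ℕ × ℕ => Eprime c s Ω f (u p.1) (fun x => u p.1 x - u p.2 x))
      atTop (nhds 0) :=
    squeeze_zero_norm (fun p => hEp p.1 p) (hεK.comp tendsto_fst_atTop)
  have hE2 : Tendsto (fun p : ℕ × ℕ => Eprime c s Ω f (u p.2) (fun x => u p.1 x - u p.2 x))
      atTop (nhds 0) :=
    squeeze_zero_norm (fun p => hEp p.2 p) (hεK.comp tendsto_snd_atTop)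
  have h := ((hE1.sub hE2).add hN1).sub hN2
  simp only [sub_zero, add_zero] at h
  refine h.congr fun p => ?_
  rw [Eprime_sub (hu p.1) (hu p.2)]
  ring

end PalaisSmale

/-- the energy functional of the truncated problem satisfies the
Palais–Smale condition on `H^s_{Ω,0}`. -/
theorem statement12 {n : ℕ} (hn : 1 ≤ n) {s c R₀ R ℓ C₀ : ℝ}
    (hs : s ∈ Ioo (1/2 : ℝ) 1) (hc : 0 < c) (hR₀ : 0 ≤ R₀) (hR : R₀ < R)
    (hℓ : 2 < ℓ) (hℓsub : 2 * s < n → ℓ < 2 * n / ((n:ℝ) - 2 * s))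
    (Ω : Set (En n)) (hΩ : Ω = annR n R₀ R)
    (ftil : ℝ → ℝ) (hC₀ : 0 < C₀)
    (hdiff : ContDiffOn ℝ 1 ftil (Ici 0))
    (hzero : ∀ t < (0:ℝ), ftil t = 0)
    (hnonneg : ∀ t, 0 ≤ ftil t)
    (hlim : Tendsto (fun t => ftil t / t ^ (ℓ - 1)) atTop (nhds 1))
    (hgrowth : ∀ t ≥ (0:ℝ), ftil t ≤ C₀ * (1 + t ^ (ℓ - 1)))
    (u : ℕ → En n → ℝ) (hmem : ∀ k, MemHs s Ω (u k))
    (hEbdd : ∃ B : ℝ, ∀ k, |energy c s Ω ftil (u k)| ≤ B)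
    (hE' : ∃ ε : ℕ → ℝ, Tendsto ε atTop (nhds 0) ∧
      ∀ k, ∀ v : En n → ℝ, MemHs s Ω v →
        |Eprime c s Ω ftil (u k) v| ≤ ε k * HsNorm c s Ω v) :
    ∃ (v : En n → ℝ) (ψ : ℕ → ℕ), MemHs s Ω v ∧ StrictMono ψ ∧
      Tendsto (fun k => HsNorm c s Ω (fun x => u (ψ k) x - v x)) atTop (nhds 0) := by
  subst hΩ
  have hs0 : 0 < s := by linarith [hs.1]
  obtain ⟨κ, r₀, hΩ⟩ := isThick_annR hn hR₀ hR
  obtain ⟨q, hlq, hq⟩ := exists_boundedInLp hn hs0 hΩ hℓsub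
  have hl := hq.of_le hΩ (by linarith) hlq.le
  have hf : IsSubcritical ftil ℓ C₀ := ⟨hℓ, hC₀,
    measurable_of_continuousOn_Ici hdiff.continuousOn hzero, hzero, hnonneg, hgrowth, hlim⟩
  obtain ⟨B, hB⟩ := hEbdd
  obtain ⟨ε, hε, hEε⟩ := hE'
  obtain ⟨M, hM⟩ := hε.bddAbove_range
  obtain ⟨A, hA, huA⟩ := hf.exists_hsSq_le (M := max M 0) hΩ hl hc hmem hB
    (fun k => (hEε k _ (hmem k)).trans (mul_le_mul_of_nonneg_right
      (le_max_of_le_left (hM (mem_range_self k))) (HsNorm_nonneg hc))) (le_max_right _ _)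
  have hA' : 0 ≤ 2 / c * A := by positivity
  obtain ⟨φ, hφ, hL⟩ := exists_subseq_cauchy_l2E hs0 hΩ (fun k => (hmem k).1)
    (A := A + 2 / c * A) (by linarith)
    (fun k => ((hmem k).l2E_le_hsSq hc).trans
      (ENNReal.ofReal_le_ofReal (by linarith [huA k])))
    (fun k => ((hmem k).gagE_le_hsSq hc).trans (ENNReal.ofReal_le_ofReal
      (by linarith [mul_le_mul_of_nonneg_left (huA k) (by positivity : 0 ≤ 2 / c)])))
  have hw := hf.tendsto_hsSq_sub hΩ hlq hq hc hA (fun k => hmem (φ k)) (fun k => huA (φ k))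
    (hε.comp hφ.tendsto_atTop) (fun k => hEε (φ k)) hL
  have hG : Tendsto (fun p : ℕ × ℕ => gagE s (annR n R₀ R)
      (fun x => u (φ p.1) x - u (φ p.2) x)) atTop (nhds 0) := by
    have h := ENNReal.tendsto_ofReal (hw.const_mul (2 / c))
    rw [mul_zero, ENNReal.ofReal_zero] at h
    exact tendsto_of_tendsto_of_tendsto_of_le_of_le tendsto_const_nhds h (fun _ => zero_le)
      fun p => ((hmem _).sub (hmem _)).gagE_le_hsSq hc
  obtain ⟨v, ψ, hv, hψ, hlim⟩ := exists_limit_of_cauchy hs0 hΩ (fun k => hmem (φ k)) hL hG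
  exact ⟨v, φ ∘ ψ, hv, hφ.comp hψ, hlim⟩

end
end

section
/- Let n ≥ 1, s ∈ (1/2,1), 0 ≤ R₀ < R, Ω = A_{R₀,R}. Let f̃ : ℝ → ℝ be continuous, non-negative, identically 0 on (−∞,0], and let 0 ≤ u_− < u₀ < u_+ < ∞ be real numbers such that t − f̃(t) > 0 for all t ∈ (u_−, u₀) and t − f̃(t) < 0 for all t ∈ (u₀, u_+). Set 𝒞_* := {u ∈ 𝒞₊(Ω) : u_− ≤ u ≤ u_+ a.e. in Ω} and fix τ ∈ (0, min{u₀ − u_−, u_+ − u₀}). Then there exists α > 0 such that E(u) ≥ E(u_− · 𝟙) + α for every u ∈ 𝒞_* with ess sup_Ω |u − u_−| = τ, where u_− · 𝟙 denotes the constant function equal to u_− on ℝⁿ (for which E(u_− · 𝟙) = |Ω| (u_−²/2 − F̃(u_−))). -/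
open MeasureTheory Filter Set

noncomputable section

/-- If the increments of `g` all stay below a geometric sequence `a * q ^ k`, then `g` cannot
rise by more than `a / (1 - q)`. -/
lemma exists_geometric_le_increment {g : ℕ → ℝ} {a q : ℝ} (ha : 0 ≤ a) (hq : 0 ≤ q)
    (hq1 : q < 1) {N : ℕ} (hN : g 0 + a / (1 - q) < g N) :
    ∃ k, a * q ^ k ≤ g (k + 1) - g k := by
  by_contra! hlt
  have hq' : 0 < 1 - q := by linarith
  have key : ∀ m, g m ≤ g 0 + a / (1 - q) * (1 - q ^ m) := by
    intro m
    induction m with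
    | zero => simp
    | succ m ih =>
      have hstep : a / (1 - q) * (1 - q ^ (m + 1)) = a / (1 - q) * (1 - q ^ m) + a * q ^ m := by
        field_simp
        ring
      linarith [hlt m]
  have : a / (1 - q) * (1 - q ^ N) ≤ a / (1 - q) :=
    mul_le_of_le_one_right (by positivity) (by linarith [pow_nonneg hq N])
  linarith [key N]

lemma measurableSet_annR (n : ℕ) (R₀ R : ℝ) : MeasurableSet (annR n R₀ R) := by
  unfold annR
  split_ifs
  · exact measurableSet_ball
  · exact (measurableSet_lt measurable_const measurable_norm).inter
      (measurableSet_lt measurable_norm measurable_const)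

lemma annR_subset_ball (n : ℕ) (R₀ R : ℝ) : annR n R₀ R ⊆ Metric.ball 0 R := by
  unfold annR
  split_ifs
  · exact subset_rfl
  · intro x hx
    simpa using hx.2

lemma norm_mem_Icc_of_mem_annR {n : ℕ} {R₀ R : ℝ} {x : En n} (hx : x ∈ annR n R₀ R) :
    ‖x‖ ∈ Icc R₀ R := by
  unfold annR at hx
  split_ifs at hx with h
  · simp only [Metric.mem_ball, dist_zero_right] at hx
    exact ⟨h ▸ norm_nonneg x, hx.le⟩
  · exact ⟨hx.1.le, hx.2.le⟩

lemma mem_annR_of_lt {n : ℕ} {R₀ R : ℝ} {x : En n} (h₀ : R₀ < ‖x‖) (h : ‖x‖ < R) :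
    x ∈ annR n R₀ R := by
  unfold annR
  split_ifs
  · simpa using h
  · exact ⟨h₀, h⟩

lemma volume_annR_ne_top (n : ℕ) (R₀ R : ℝ) : volume (annR n R₀ R) ≠ ⊤ :=
  ((measure_mono (annR_subset_ball n R₀ R)).trans_lt measure_ball_lt_top).ne

lemma measurableSet_crossSet {n : ℕ} {Ω : Set (En n)} (hΩ : MeasurableSet Ω) :
    MeasurableSet (crossSet Ω) :=
  (measurable_fst hΩ).union (measurable_snd hΩ)

lemma setIntegral_gagSq_nonneg {n : ℕ} (s : ℝ) (Ω : Set (En n)) (u : En n → ℝ) :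
    0 ≤ ∫ p in crossSet Ω, gagSq s u p :=
  integral_nonneg fun p => gagSq_nonneg s u p

/-- The half-open shell `{a ≤ |x| < b}`. -/
def shell (n : ℕ) (a b : ℝ) : Set (En n) := {x | a ≤ ‖x‖ ∧ ‖x‖ < b}

lemma measurableSet_shell (n : ℕ) (a b : ℝ) : MeasurableSet (shell n a b) :=
  (measurableSet_le measurable_const measurable_norm).inter
    (measurableSet_lt measurable_norm measurable_const)

lemma shell_subset_annR {n : ℕ} {R₀ R a : ℝ} (h : R₀ < a) : shell n a R ⊆ annR n R₀ R :=
  fun _ hx => mem_annR_of_lt (h.trans_le hx.1) hx.2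

lemma volume_real_ball_zero {n : ℕ} (hn : 1 ≤ n) (x : En n) {r : ℝ} (hr : 0 ≤ r) :
    volume.real (Metric.ball x r) = r ^ n * volume.real (Metric.ball (0 : En n) 1) := by
  have : Nontrivial (En n) := by
    have : Nonempty (Fin n) := ⟨⟨0, hn⟩⟩
    infer_instance
  rw [Measure.real, Measure.addHaar_ball _ _ hr, ENNReal.toReal_mul,
    ENNReal.toReal_ofReal (by positivity), finrank_euclideanSpace_fin, Measure.real]

lemma volume_real_unit_ball_pos (n : ℕ) : 0 < volume.real (Metric.ball (0 : En n) 1) :=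
  ENNReal.toReal_pos (Metric.measure_ball_pos _ _ one_pos).ne' measure_ball_lt_top.ne

lemma volume_shell_ne_top (n : ℕ) (a b : ℝ) : volume (shell n a b) ≠ ⊤ := by
  refine ((measure_mono (t := Metric.ball 0 b) fun x hx => ?_).trans_lt measure_ball_lt_top).ne
  simpa using hx.2

lemma le_volume_real_shell {n : ℕ} (hn : 1 ≤ n) {a b : ℝ} (ha : 0 ≤ a) (hab : a ≤ b) :
    (b - a) * a ^ (n - 1) * volume.real (Metric.ball (0 : En n) 1) ≤
      volume.real (shell n a b) := by
  have heq : shell n a b = Metric.ball 0 b \ Metric.ball 0 a := by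
    ext x
    simp [shell, and_comm]
  rw [heq, measureReal_sdiff (Metric.ball_subset_ball hab) measurableSet_ball
    measure_ball_lt_top.ne, volume_real_ball_zero hn _ (ha.trans hab),
    volume_real_ball_zero hn _ ha, ← sub_mul]
  gcongr
  obtain ⟨m, rfl⟩ : ∃ m, n = m + 1 := ⟨n - 1, by omega⟩
  have : a ^ m * b ≤ b ^ m * b := by
    have := ha.trans hab
    gcongr
  rw [Nat.add_sub_cancel, pow_succ, pow_succ]
  linarith

/-- Pairs of points at distance at most `2h`, lying respectively between `h` and `2h`, and within
`h / 2`, of the sphere of radius `R`, inside the ball of radius `R`. -/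
def nearbyPairs (n : ℕ) (R h : ℝ) : Set (En n × En n) :=
  {p | p.1 ∈ shell n (R - 2 * h) (R - h) ∧ p.2 ∈ shell n (R - h / 2) R ∧ dist p.1 p.2 ≤ 2 * h}

lemma measurableSet_nearbyPairs (n : ℕ) (R h : ℝ) : MeasurableSet (nearbyPairs n R h) :=
  (measurable_fst (measurableSet_shell n _ _)).inter
    ((measurable_snd (measurableSet_shell n _ _)).inter
      (measurableSet_le (measurable_fst.dist measurable_snd) measurable_const))

lemma volume_nearbyPairs_ne_top (n : ℕ) (R h : ℝ) : volume (nearbyPairs n R h) ≠ ⊤ := by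
  refine ((measure_mono (t := shell n (R - 2 * h) (R - h) ×ˢ shell n (R - h / 2) R)
    fun p hp => ⟨hp.1, hp.2.1⟩).trans_lt ?_).ne
  rw [Measure.volume_eq_prod, Measure.prod_prod]
  exact ENNReal.mul_lt_top (volume_shell_ne_top _ _ _).lt_top (volume_shell_ne_top _ _ _).lt_top

/-- Above each `x` in the inner shell, the fibre of `nearbyPairs` contains a ball of radius `h / 4`
centred on the ray through `x`. -/
lemma ball_subset_nearbyPairs_fibre {n : ℕ} {R h : ℝ} (hh : 0 < h) (hR : 0 < R - 2 * h)
    {x : En n} (hx : x ∈ shell n (R - 2 * h) (R - h)) :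
    Metric.ball (((R - h / 4) / ‖x‖) • x) (h / 4) ⊆ Prod.mk x ⁻¹' nearbyPairs n R h := by
  intro y hy
  have hx0 : 0 < ‖x‖ := hR.trans_le hx.1
  set z := ((R - h / 4) / ‖x‖) • x with hz
  have hzn : ‖z‖ = R - h / 4 := by
    rw [hz, norm_smul, norm_div, norm_norm, div_mul_cancel₀ _ hx0.ne', Real.norm_of_nonneg]
    linarith
  have hxz : ‖x - z‖ = R - h / 4 - ‖x‖ := by
    have : x - z = (1 - (R - h / 4) / ‖x‖) • x := by rw [sub_smul, one_smul]
    rw [this, norm_smul, Real.norm_eq_abs, abs_sub_comm, abs_of_nonneg, sub_mul, one_mul,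
      div_mul_cancel₀ _ hx0.ne']
    rw [sub_nonneg, one_le_div hx0]
    linarith [hx.2]
  have hyz : ‖y - z‖ < h / 4 := by rwa [← dist_eq_norm]
  have h₁ : ‖y‖ ≤ ‖z‖ + ‖y - z‖ := by
    simpa using norm_add_le z (y - z)
  have h₂ : ‖z‖ ≤ ‖y‖ + ‖y - z‖ := by
    simpa using norm_sub_le y (y - z)
  have h₃ : dist x y ≤ ‖x - z‖ + ‖y - z‖ := by
    rw [← dist_eq_norm, ← dist_eq_norm]
    exact dist_triangle_right x y z
  refine ⟨hx, ⟨?_, ?_⟩, ?_⟩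
  · linarith
  · linarith
  · linarith [hx.1]

lemma le_volume_real_nearbyPairs {n : ℕ} (hn : 1 ≤ n) {R h : ℝ} (hh : 0 < h)
    (hR : 0 < R - 2 * h) :
    (h * (R - 2 * h) ^ (n - 1) * volume.real (Metric.ball (0 : En n) 1)) *
      ((h / 4) ^ n * volume.real (Metric.ball (0 : En n) 1)) ≤
      volume.real (nearbyPairs n R h) := by
  set w := volume.real (Metric.ball (0 : En n) 1)
  have hfib : ∀ x ∈ shell n (R - 2 * h) (R - h),
      ENNReal.ofReal ((h / 4) ^ n * w) ≤ volume (Prod.mk x ⁻¹' nearbyPairs n R h) := by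
    intro x hx
    rw [← volume_real_ball_zero hn (((R - h / 4) / ‖x‖) • x) (by positivity : 0 ≤ h / 4),
      ofReal_measureReal measure_ball_lt_top.ne]
    exact measure_mono (ball_subset_nearbyPairs_fibre hh hR hx)
  have hvol : ENNReal.ofReal ((h / 4) ^ n * w) * volume (shell n (R - 2 * h) (R - h)) ≤
      volume (nearbyPairs n R h) := by
    rw [Measure.volume_eq_prod, Measure.prod_apply (measurableSet_nearbyPairs n R h),
      ← setLIntegral_const]
    exact (setLIntegral_mono' (measurableSet_shell n _ _) hfib).trans
      (setLIntegral_le_lintegral _ _)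
  have hreal := ENNReal.toReal_mono (volume_nearbyPairs_ne_top n R h) hvol
  rw [ENNReal.toReal_mul, ENNReal.toReal_ofReal (by positivity)] at hreal
  have hshell := le_volume_real_shell hn hR.le (by linarith : R - 2 * h ≤ R - h)
  rw [show R - h - (R - 2 * h) = h by ring] at hshell
  calc _ ≤ volume.real (shell n (R - 2 * h) (R - h)) * ((h / 4) ^ n * w) := by gcongr
    _ ≤ _ := by rw [mul_comm]; exact hreal

/-- A radially non-decreasing function that jumps by at least `b h ^ (s - 1/2)` between the radii
`R - h` and `R - h / 2` has Gagliardo energy bounded below independently of `h`. -/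
lemma le_setIntegral_gagSq_of_increment {n : ℕ} (hn : 1 ≤ n) {s R₀ R ρ h b : ℝ} (hs : 0 < s)
    (hR₀ : 0 ≤ R₀) (hρ : R₀ < ρ) (hh : 0 < h) (hρh : ρ ≤ R - 2 * h) (hb : 0 ≤ b)
    {u : En n → ℝ} {φ : ℝ → ℝ} (hu : IntegrableOn (gagSq s u) (crossSet (annR n R₀ R)))
    (hφ : IsRadialWith u φ) (hmono : MonotoneOn φ (Icc R₀ R))
    (hinc : b * h ^ (s - 1 / 2) ≤ φ (R - h / 2) - φ (R - h)) :
    b ^ 2 * (ρ ^ (n - 1) * volume.real (Metric.ball (0 : En n) 1) ^ 2 /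
      (4 ^ n * 2 ^ ((n : ℝ) + 2 * s))) ≤ ∫ p in crossSet (annR n R₀ R), gagSq s u p := by
  set w := volume.real (Metric.ball (0 : En n) 1)
  have hρ0 : 0 < ρ := hR₀.trans_lt hρ
  have hsub : nearbyPairs n R h ⊆ crossSet (annR n R₀ R) := fun p hp =>
    Or.inl (mem_annR_of_lt (by linarith [hp.1.1]) (by linarith [hp.1.2]))
  have hpt : ∀ p ∈ nearbyPairs n R h,
      (b * h ^ (s - 1 / 2)) ^ 2 / (2 * h) ^ ((n : ℝ) + 2 * s) ≤ gagSq s u p := by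
    rintro ⟨x, y⟩ ⟨⟨hx₁, hx₂⟩, ⟨hy₁, hy₂⟩, hxy⟩
    dsimp only at hx₁ hx₂ hy₁ hy₂ hxy
    have hdist : 0 < dist x y := by
      rw [dist_pos]
      rintro rfl
      linarith
    have hφx : φ ‖x‖ ≤ φ (R - h) :=
      hmono ⟨by linarith, by linarith⟩ ⟨by linarith, by linarith⟩ hx₂.le
    have hφy : φ (R - h / 2) ≤ φ ‖y‖ :=
      hmono ⟨by linarith, by linarith⟩ ⟨by linarith, by linarith⟩ hy₁
    have habs : b * h ^ (s - 1 / 2) ≤ |u x - u y| := by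
      rw [hφ x, hφ y, abs_sub_comm]
      exact le_trans (by linarith) (le_abs_self _)
    unfold gagSq
    dsimp only
    gcongr
  have hint := setIntegral_ge_of_const_le_real (measurableSet_nearbyPairs n R h)
    (volume_nearbyPairs_ne_top n R h) hpt (hu.mono_set hsub)
  have hmonoset := setIntegral_mono_set hu
    (Eventually.of_forall fun p => gagSq_nonneg s u p) hsub.eventuallyLE
  refine le_trans ?_ (hint.trans hmonoset)
  have hpow : (2 * h) ^ ((n : ℝ) + 2 * s) =
      2 ^ ((n : ℝ) + 2 * s) * (h ^ n * (h * (h ^ (s - 1 / 2)) ^ 2)) := by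
    rw [Real.mul_rpow zero_le_two hh.le]
    congr 1
    rw [← Real.rpow_natCast (h ^ (s - 1 / 2)), ← Real.rpow_mul hh.le, ← Real.rpow_natCast h n]
    nth_rewrite 3 [← Real.rpow_one h]
    rw [← Real.rpow_add hh, ← Real.rpow_add hh]
    congr 1
    push_cast
    ring
  calc _ = (b * h ^ (s - 1 / 2)) ^ 2 / (2 * h) ^ ((n : ℝ) + 2 * s) *
        ((h * ρ ^ (n - 1) * w) * ((h / 4) ^ n * w)) := by
        rw [hpow, div_pow]
        field_simp
    _ ≤ (b * h ^ (s - 1 / 2)) ^ 2 / (2 * h) ^ ((n : ℝ) + 2 * s) *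
        ((h * (R - 2 * h) ^ (n - 1) * w) * ((h / 4) ^ n * w)) := by gcongr
    _ ≤ _ := by
        gcongr
        exact le_volume_real_nearbyPairs hn hh (by linarith)

/-- A quantitative form, for radially non-decreasing functions, of the absence of jumps in `H^s`
for `s > 1/2`: a fixed rise near the outer boundary costs a fixed amount of Gagliardo energy. -/
lemma exists_pos_le_setIntegral_gagSq {n : ℕ} (hn : 1 ≤ n) {s R₀ R ℓ δ : ℝ} (hs : 1 / 2 < s)
    (hR₀ : 0 ≤ R₀) (hℓ : 0 < ℓ) (hℓR : R₀ < R - 2 * ℓ) (hδ : 0 < δ) :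
    ∃ κ > (0 : ℝ), ∀ (u : En n → ℝ) (φ : ℝ → ℝ),
      IntegrableOn (gagSq s u) (crossSet (annR n R₀ R)) → IsRadialWith u φ →
      MonotoneOn φ (Icc R₀ R) → (∃ r, R₀ < r ∧ r < R ∧ φ (R - ℓ) + δ < φ r) →
      κ ≤ ∫ p in crossSet (annR n R₀ R), gagSq s u p := by
  set q : ℝ := (1 / 2) ^ (s - 1 / 2)
  have hq0 : 0 < q := by positivity
  have hq1 : q < 1 := Real.rpow_lt_one (by norm_num) (by norm_num) (by linarith)
  have hq' : 0 < 1 - q := by linarith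
  set b : ℝ := δ * (1 - q) / ℓ ^ (s - 1 / 2)
  have hb : 0 < b := by positivity
  have hw := volume_real_unit_ball_pos n
  have hρ : 0 < R - 2 * ℓ := hR₀.trans_lt hℓR
  refine ⟨b ^ 2 * ((R - 2 * ℓ) ^ (n - 1) * volume.real (Metric.ball (0 : En n) 1) ^ 2 /
      (4 ^ n * 2 ^ ((n : ℝ) + 2 * s))), by positivity, ?_⟩
  rintro u φ hu hφ hmono ⟨r, hr₀, hr, hrise⟩
  obtain ⟨N, hN⟩ := exists_pow_lt_of_lt_one (div_pos (sub_pos.2 hr) hℓ) (one_half_lt_one (α := ℝ))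
  rw [lt_div_iff₀ hℓ] at hN
  have hle : ∀ k : ℕ, (1 / 2 : ℝ) ^ k * ℓ ≤ ℓ := fun k =>
    mul_le_of_le_one_left hℓ.le (pow_le_one₀ (by norm_num) (by norm_num))
  have hpos : ∀ k : ℕ, 0 < (1 / 2 : ℝ) ^ k * ℓ := fun k => by positivity
  have hφN : φ r ≤ φ (R - (1 / 2) ^ N * ℓ) :=
    hmono ⟨hr₀.le, hr.le⟩ ⟨by linarith [hle N], by linarith [hpos N]⟩ (by linarith)
  obtain ⟨k, hk⟩ := exists_geometric_le_increment (g := fun k => φ (R - (1 / 2) ^ k * ℓ))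
    (a := δ * (1 - q)) (N := N) (by positivity) hq0.le hq1
    (by
      rw [mul_div_cancel_right₀ _ hq'.ne', pow_zero, one_mul]
      exact hrise.trans_le hφN)
  refine le_setIntegral_gagSq_of_increment hn (h := (1 / 2) ^ k * ℓ) (by linarith) hR₀ hℓR
    (hpos k) (by linarith [hle k]) hb.le hu hφ hmono ?_
  have hscale : b * ((1 / 2) ^ k * ℓ) ^ (s - 1 / 2) = δ * (1 - q) * q ^ k := by
    have : q ^ k = ((1 / 2 : ℝ) ^ k) ^ (s - 1 / 2) := by
      rw [← Real.rpow_mul_natCast (by norm_num), ← Real.rpow_natCast_mul (by norm_num), mul_comm]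
    rw [Real.mul_rpow (by positivity) hℓ.le, this]
    simp only [b]
    field_simp
  rw [hscale]
  convert hk using 4
  ring

/-- The pointwise energy density `t² / 2 - ∫₀ᵗ f`. -/
def potential (f : ℝ → ℝ) (t : ℝ) : ℝ := t ^ 2 / 2 - ∫ τ in (0 : ℝ)..t, f τ

lemma hasDerivAt_potential {f : ℝ → ℝ} (hf : Continuous f) (t : ℝ) :
    HasDerivAt (potential f) (t - f t) t := by
  have h := (((hasDerivAt_id t).pow 2).div_const 2).sub
    (hf.integral_hasStrictDerivAt 0 t).hasDerivAt
  refine h.congr_deriv ?_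
  simp

lemma continuous_potential {f : ℝ → ℝ} (hf : Continuous f) : Continuous (potential f) :=
  continuous_iff_continuousAt.2 fun t => (hasDerivAt_potential hf t).continuousAt

lemma strictMonoOn_potential {f : ℝ → ℝ} (hf : Continuous f) {a b : ℝ}
    (hsign : ∀ t, a < t → t < b → 0 < t - f t) : StrictMonoOn (potential f) (Icc a b) := by
  refine strictMonoOn_of_deriv_pos (convex_Icc a b) (continuous_potential hf).continuousOn ?_
  intro t ht
  rw [interior_Icc] at ht
  rw [(hasDerivAt_potential hf t).deriv]
  exact hsign t ht.1 ht.2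

/-- A continuous function of an essentially bounded function is integrable on a set of finite
measure. -/
lemma integrableOn_comp_of_ae_mem_Icc {α : Type*} [MeasurableSpace α] {μ : Measure α} {S : Set α}
    {g : ℝ → ℝ} {u : α → ℝ} {a b : ℝ} (hS : μ S ≠ ⊤) (hg : Continuous g) (hu : Measurable u)
    (hab : ∀ᵐ x ∂μ.restrict S, u x ∈ Icc a b) : IntegrableOn (fun x => g (u x)) S μ := by
  obtain ⟨M, hM⟩ := isCompact_Icc.exists_bound_of_continuousOn (hg.continuousOn (s := Icc a b))
  exact Measure.integrableOn_of_bounded hS (hg.measurable.comp hu).aestronglyMeasurable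
    (hab.mono fun x hx => hM _ hx)

lemma energy_eq_add_setIntegral_potential {n : ℕ} (c s : ℝ) {Ω : Set (En n)} {f : ℝ → ℝ}
    {u : En n → ℝ} {a b : ℝ} (hΩ : volume Ω ≠ ⊤) (hf : Continuous f) (hu : Measurable u)
    (hab : ∀ᵐ x ∂volume.restrict Ω, u x ∈ Icc a b) :
    energy c s Ω f u =
      c / 4 * (∫ p in crossSet Ω, gagSq s u p) + ∫ x in Ω, potential f (u x) := by
  have hF : Continuous fun t => ∫ τ in (0 : ℝ)..t, f τ :=
    continuous_iff_continuousAt.2 fun t => (hf.integral_hasStrictDerivAt 0 t).hasDerivAt.continuousAt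
  have h₁ := integrableOn_comp_of_ae_mem_Icc (g := fun t => t ^ 2 / 2) hΩ (by fun_prop) hu hab
  have h₂ := integrableOn_comp_of_ae_mem_Icc hΩ hF hu hab
  unfold energy potential
  rw [integral_sub h₁ h₂, integral_div]
  ring

lemma energy_const {n : ℕ} (c s : ℝ) {Ω : Set (En n)} {f : ℝ → ℝ} (hΩ : volume Ω ≠ ⊤)
    (hf : Continuous f) (a : ℝ) :
    energy c s Ω f (fun _ => a) = ∫ _ in Ω, potential f a := by
  rw [energy_eq_add_setIntegral_potential c s hΩ hf measurable_const (a := a) (b := a)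
    (by simp)]
  simp [gagSq]

/-- mountain pass geometry — energy barrier around the constant `u₋` inside
the restricted cone. -/
theorem statement15 {n : ℕ} (hn : 1 ≤ n) {s c R₀ R um u₀ up τ : ℝ}
    (hs : s ∈ Ioo (1/2 : ℝ) 1) (hc : 0 < c) (hR₀ : 0 ≤ R₀) (hR : R₀ < R)
    (Ω : Set (En n)) (hΩ : Ω = annR n R₀ R)
    (ftil : ℝ → ℝ) (hcont : Continuous ftil) (hnonneg : ∀ t, 0 ≤ ftil t)
    (hzero : ∀ t ≤ (0:ℝ), ftil t = 0)
    (hum : 0 ≤ um) (h1 : um < u₀) (h2 : u₀ < up)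
    (hsign1 : ∀ t, um < t → t < u₀ → 0 < t - ftil t)
    (hsign2 : ∀ t, u₀ < t → t < up → t - ftil t < 0)
    (hτ : 0 < τ) (hτ2 : τ < min (u₀ - um) (up - u₀)) :
    ∃ α > (0:ℝ), ∀ u : En n → ℝ,
      InConePlus s R₀ R Ω u →
      (∀ᵐ x ∂(volume.restrict Ω), um ≤ u x ∧ u x ≤ up) →
      essSup (fun x => |u x - um|) (volume.restrict Ω) = τ →
      energy c s Ω ftil (fun _ => um) + α ≤ energy c s Ω ftil u := by
  subst hΩ
  have hum₀ : um + τ < u₀ := by linarith [hτ2.trans_le (min_le_left _ _)]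
  have hΩm := measurableSet_annR n R₀ R
  have hΩfin := volume_annR_ne_top n R₀ R
  have hH := strictMonoOn_potential hcont hsign1
  set ℓ := (R - R₀) / 4
  have hℓ : 0 < ℓ := by simp only [ℓ]; linarith
  have hℓR : R₀ < R - 2 * ℓ := by simp only [ℓ]; linarith
  obtain ⟨κ, hκ, hgag⟩ :=
    exists_pos_le_setIntegral_gagSq hn hs.1 hR₀ hℓ hℓR (by positivity : 0 < τ / 4)
  have hshell : 0 < volume.real (shell n (R - ℓ) R) := by
    refine lt_of_lt_of_le ?_ (le_volume_real_shell hn (by linarith) (by linarith))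
    have : 0 < R - ℓ := by linarith
    have := volume_real_unit_ball_pos n
    rw [sub_sub_cancel]
    positivity
  have hgap : 0 < potential ftil (um + τ / 2) - potential ftil um :=
    sub_pos.2 (hH ⟨le_rfl, h1.le⟩ ⟨by linarith, by linarith⟩ (by linarith))
  refine ⟨min (c / 4 * κ)
    ((potential ftil (um + τ / 2) - potential ftil um) * volume.real (shell n (R - ℓ) R)),
    by positivity, ?_⟩
  rintro u ⟨⟨hum_u, -, hugag⟩, -, φ, hφ, hmono⟩ hbd hess
  have hΩ0 : volume (annR n R₀ R) ≠ 0 := by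
    intro h0
    have := measureReal_mono (shell_subset_annR (n := n) (by linarith : R₀ < R - ℓ)) hΩfin
    rw [Measure.real, Measure.real, h0] at this
    simp only [ENNReal.toReal_zero] at this
    exact absurd hshell (not_lt.2 this)
  have hle : ∀ᵐ x ∂volume.restrict (annR n R₀ R), u x ∈ Icc um (um + τ) := by
    have hsup : ∀ᵐ x ∂volume.restrict (annR n R₀ R), |u x - um| ≤ τ := by
      rw [← hess]
      exact ae_le_essSup ⟨up - um, eventually_map.2 <| hbd.mono fun x hx =>
        abs_le.2 ⟨by linarith [hx.1], by linarith [hx.2]⟩⟩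
    filter_upwards [hbd, hsup] with x hx hx'
    exact ⟨hx.1, by linarith [le_abs_self (u x - um)]⟩
  have hint : IntegrableOn (fun x => potential ftil (u x) - potential ftil um) (annR n R₀ R) :=
    integrableOn_comp_of_ae_mem_Icc hΩfin ((continuous_potential hcont).sub continuous_const)
      hum_u hle
  have hnn : 0 ≤ᵐ[volume.restrict (annR n R₀ R)]
      fun x => potential ftil (u x) - potential ftil um :=
    hle.mono fun x hx => sub_nonneg.2
      (hH.monotoneOn ⟨le_rfl, h1.le⟩ ⟨hx.1, hx.2.trans hum₀.le⟩ hx.1)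
  have hdiff : energy c s (annR n R₀ R) ftil u = energy c s (annR n R₀ R) ftil (fun _ => um) +
      (c / 4 * (∫ p in crossSet (annR n R₀ R), gagSq s u p) +
        ∫ x in annR n R₀ R, (potential ftil (u x) - potential ftil um)) := by
    rw [energy_eq_add_setIntegral_potential c s hΩfin hcont hum_u hle,
      energy_const c s hΩfin hcont, integral_sub (integrableOn_comp_of_ae_mem_Icc hΩfin
        (continuous_potential hcont) hum_u hle) (integrableOn_const hΩfin)]
    ring
  rw [hdiff]
  gcongr
  rcases le_or_gt (φ (R - ℓ)) (um + τ / 2) with hsmall | hlarge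
  · have hrise : ∃ r, R₀ < r ∧ r < R ∧ φ (R - ℓ) + τ / 4 < φ r := by
      by_contra! hno
      have hae : ∀ᵐ x ∂volume.restrict (annR n R₀ R), |u x - um| ≤ 3 * τ / 4 := by
        filter_upwards [hle, ae_restrict_mem hΩm] with x hx hxΩ
        have hxR : ‖x‖ < R := by simpa using annR_subset_ball n R₀ R hxΩ
        have hxI := norm_mem_Icc_of_mem_annR hxΩ
        have hφx : φ ‖x‖ ≤ φ (R - ℓ) + τ / 4 := by
          rcases hxI.1.eq_or_lt with heq | hlt
          · have := hmono hxI ⟨by linarith, by linarith⟩ (by linarith : ‖x‖ ≤ R - ℓ)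
            linarith
          · exact hno _ hlt hxR
        rw [abs_of_nonneg (sub_nonneg.2 hx.1), hφ x]
        linarith
      have : NeBot (ae (volume.restrict (annR n R₀ R))) := by
        rw [ae_neBot]
        exact fun h => hΩ0 (Measure.restrict_eq_zero.1 h)
      have := essSup_le_of_ae_le _ hae
        (isCoboundedUnder_le_of_le _ fun x => abs_nonneg (u x - um))
      linarith
    have h₁ := hgag u φ hugag hφ hmono hrise
    have h₂ := integral_nonneg_of_ae hnn
    calc _ ≤ c / 4 * κ := min_le_left _ _
      _ ≤ c / 4 * (∫ p in crossSet (annR n R₀ R), gagSq s u p) := by gcongr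
      _ ≤ _ := le_add_of_nonneg_right h₂
  · have hsub := shell_subset_annR (n := n) (by linarith : R₀ < R - ℓ) (R := R)
    have h₀ := mul_nonneg (by positivity : 0 ≤ c / 4)
      (setIntegral_gagSq_nonneg s (annR n R₀ R) u)
    have hpt : ∀ᵐ x ∂volume.restrict (shell n (R - ℓ) R),
        potential ftil (um + τ / 2) - potential ftil um ≤
          potential ftil (u x) - potential ftil um := by
      filter_upwards [ae_restrict_of_ae_restrict_of_subset hsub hle,
        ae_restrict_mem (measurableSet_shell n (R - ℓ) R)] with x hx hxs
      refine sub_le_sub_right (hH.monotoneOn ⟨by linarith, by linarith⟩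
        ⟨hx.1, hx.2.trans hum₀.le⟩ ?_) _
      rw [hφ x]
      exact hlarge.le.trans
        (hmono ⟨by linarith, by linarith⟩ (norm_mem_Icc_of_mem_annR (hsub hxs)) hxs.1)
    have h₁ := setIntegral_mono_ae_restrict
      (integrableOn_const (volume_shell_ne_top n (R - ℓ) R)) (hint.mono_set hsub) hpt
    rw [setIntegral_const, smul_eq_mul, mul_comm] at h₁
    exact (min_le_right _ _).trans <| (h₁.trans (setIntegral_mono_set hint hnn
      hsub.eventuallyLE)).trans (le_add_of_nonneg_left h₀)

end
end
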